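/- arXiv:1306.5316 — 2 statements merged into one kernel-verified Lean document; each statement's English description precedes it below -/
import Mathlib

section
/- Every 2-connected, claw-free, almost distance-hereditary graph on at least 3 vertices is Hamiltonian. -/
open SimpleGraph

/-- A vertex is heavy if its degree is at least half the number of vertices. -/
def Heavy {V : Type*} [Fintype V] (G : SimpleGraph V) (v : V) : Prop :=
  Fintype.card V ≤ 2 * (G.neighborSet v).ncard

/-- `{x,y} ∈ Ẽ(G)`: distinct vertices that are adjacent or have degree sum at least `n`. -/
def TEdge {V : Type*} [Fintype V] (G : SimpleGraph V) (x y : V) : Prop :=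
  x ≠ y ∧ (G.Adj x y ∨
    Fintype.card V ≤ (G.neighborSet x).ncard + (G.neighborSet y).ncard)

/-- `a` is the center and `b,c,d` the end vertices of an induced claw `K_{1,3}`. -/
def IsClaw {V : Type*} (G : SimpleGraph V) (a b c d : V) : Prop :=
  G.Adj a b ∧ G.Adj a c ∧ G.Adj a d ∧
    ¬ G.Adj b c ∧ ¬ G.Adj b d ∧ ¬ G.Adj c d ∧ b ≠ c ∧ b ≠ d ∧ c ≠ d

/-- Every claw has at least one heavy end vertex. -/
def OneHeavy {V : Type*} [Fintype V] (G : SimpleGraph V) : Prop :=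
  ∀ a b c d, IsClaw G a b c d → Heavy G b ∨ Heavy G c ∨ Heavy G d

/-- Every claw has at least two heavy end vertices. -/
def TwoHeavy {V : Type*} [Fintype V] (G : SimpleGraph V) : Prop :=
  ∀ a b c d, IsClaw G a b c d →
    (Heavy G b ∧ Heavy G c) ∨ (Heavy G b ∧ Heavy G d) ∨ (Heavy G c ∧ Heavy G d)

/-- Every claw has two end vertices with degree sum at least `n`. -/
def ClawHeavy {V : Type*} [Fintype V] (G : SimpleGraph V) : Prop :=
  ∀ a b c d, IsClaw G a b c d →
    Fintype.card V ≤ (G.neighborSet b).ncard + (G.neighborSet c).ncard ∨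
    Fintype.card V ≤ (G.neighborSet b).ncard + (G.neighborSet d).ncard ∨
    Fintype.card V ≤ (G.neighborSet c).ncard + (G.neighborSet d).ncard

/-- `G` contains no induced claw. -/
def ClawFree {V : Type*} (G : SimpleGraph V) : Prop :=
  ∀ a b c d, ¬ IsClaw G a b c d

/-- Almost distance-hereditary: in every connected induced subgraph the distance
between two vertices exceeds their distance in `G` by at most one. -/
def AlmostDH {V : Type*} (G : SimpleGraph V) : Prop :=
  ∀ s : Set V, (G.induce s).Connected →
    ∀ x y : s, (G.induce s).dist x y ≤ G.dist (x : V) (y : V) + 1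

/-- Distance-hereditary: every connected induced subgraph preserves distances. -/
def DistHered {V : Type*} (G : SimpleGraph V) : Prop :=
  ∀ s : Set V, (G.induce s).Connected →
    ∀ x y : s, (G.induce s).dist x y = G.dist (x : V) (y : V)

/-- A cycle in `G`, encoded as an injective cyclic sequence of `m ≥ 3` pairwise
adjacent-in-order vertices. -/
def IsCycleMap {V : Type*} (G : SimpleGraph V) (m : ℕ) (f : ZMod m → V) : Prop :=
  3 ≤ m ∧ Function.Injective f ∧ ∀ i, G.Adj (f i) (f (i + 1))

/-- A longest cycle of `G`. -/
def IsLongestCycleMap {V : Type*} (G : SimpleGraph V) (m : ℕ) (f : ZMod m → V) : Prop :=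
  IsCycleMap G m f ∧ ∀ (m' : ℕ) (f' : ZMod m' → V), IsCycleMap G m' f' → m' ≤ m

/-- `R` is a connected component of the subgraph of `G` induced on `W`. -/
def IsCompOf {V : Type*} (G : SimpleGraph V) (W R : Set V) : Prop :=
  R.Nonempty ∧ R ⊆ W ∧ (G.induce R).Connected ∧
    ∀ x ∈ R, ∀ y ∈ W, G.Adj x y → y ∈ R


namespace Adh

variable {V : Type*} {G : SimpleGraph V}

/-- `l` is a nonempty walk list from `a` to `b`. -/
def Seg (G : SimpleGraph V) (l : List V) (a b : V) : Prop :=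
  l.IsChain G.Adj ∧ l.head? = some a ∧ l.getLast? = some b

lemma Seg.single (G : SimpleGraph V) (a : V) : Seg G [a] a a := by simp [Seg]

lemma Seg.append {l m : List V} {a b c d : V} (h : Seg G l a b) (h' : Seg G m c d)
    (e : G.Adj b c) : Seg G (l ++ m) a d := by
  obtain ⟨h1, h2, h3⟩ := h
  obtain ⟨k1, k2, k3⟩ := h'
  refine ⟨?_, by simp [h2], by simp [k3]⟩
  rw [List.isChain_append]
  refine ⟨h1, k1, ?_⟩
  intro x hx y hy
  rw [h3] at hx; rw [k2] at hy
  simp only [Option.mem_def, Option.some.injEq] at hx hy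
  subst hx; subst hy; exact e

lemma Seg.cons {m : List V} {b c d : V} (h' : Seg G m c d)
    (e : G.Adj b c) : Seg G (b :: m) b d := (Seg.single G b).append h' e

lemma Seg.reverse {l : List V} {a b : V} (h : Seg G l a b) : Seg G l.reverse b a := by
  obtain ⟨h1, h2, h3⟩ := h
  refine ⟨?_, by simp [h3], by simp [h2]⟩
  rw [List.isChain_reverse]
  exact h1.imp (fun _ _ h => h.symm)

lemma Seg.ne_nil {l : List V} {a b : V} (h : Seg G l a b) : l ≠ [] := by
  rintro rfl; simp [Seg] at h

lemma Seg.left_mem {l : List V} {a b : V} (h : Seg G l a b) : a ∈ l :=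
  List.mem_of_mem_head? h.2.1

lemma Seg.right_mem {l : List V} {a b : V} (h : Seg G l a b) : b ∈ l :=
  List.mem_of_mem_getLast? h.2.2

lemma exists_seg {l : List V} (h : l ≠ []) (hc : l.IsChain G.Adj) : ∃ a b, Seg G l a b :=
  ⟨l.head h, l.getLast h, hc, List.head?_eq_some_head h, List.getLast?_eq_some_getLast h⟩

lemma Seg.split {l m : List V} {a d : V} (h : Seg G (l ++ m) a d) (hl : l ≠ []) (hm : m ≠ []) :
    ∃ b c, Seg G l a b ∧ Seg G m c d ∧ G.Adj b c := by
  obtain ⟨h1, h2, h3⟩ := h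
  rw [List.isChain_append] at h1
  obtain ⟨b0, b, hb⟩ := exists_seg hl h1.1
  obtain ⟨c, d0, hc⟩ := exists_seg hm h1.2.1
  have e1 : b0 = a := by
    have := hb.2.1; simp [this] at h2; exact h2
  have e2 : d0 = d := by
    have := hc.2.2; simp [this] at h3; exact h3
  subst e1; subst e2
  exact ⟨b, c, hb, hc, h1.2.2 _ hb.2.2 _ hc.2.1⟩

lemma Seg.split_cons {m : List V} {u a d : V} (h : Seg G (u :: m) a d) (hm : m ≠ []) :
    u = a ∧ ∃ c, Seg G m c d ∧ G.Adj u c := by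
  obtain ⟨b, c, h1, h2, h3⟩ := Seg.split (l := [u]) (m := m) h (by simp) hm
  have : u = a := by simpa using h1.2.1
  have : u = b := by simpa using h1.2.2
  subst this
  exact ⟨‹_›, c, h2, h3⟩

lemma Seg.single_eq {u a d : V} (h : Seg G [u] a d) : u = a ∧ u = d := by
  simpa [Seg] using h

/-- cyclic list -/
def CycL (G : SimpleGraph V) (l : List V) : Prop := ∃ a b, Seg G l a b ∧ G.Adj b a

lemma CycL.rot {l m : List V} (h : CycL G (l ++ m)) : CycL G (m ++ l) := by
  by_cases hl : l = []
  · subst hl; simpa using h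
  by_cases hm : m = []
  · subst hm; simpa using h
  obtain ⟨a, b, h, e⟩ := h
  obtain ⟨c, d, h1, h2, h3⟩ := h.split hl hm
  exact ⟨d, c, h2.append h1 e, h3⟩

lemma CycL.reverse {l : List V} (h : CycL G l) : CycL G l.reverse := by
  obtain ⟨a, b, h, e⟩ := h
  exact ⟨b, a, h.reverse, e.symm⟩

lemma claw3 (hcf : ClawFree G) {a b c d : V} (h1 : G.Adj a b) (h2 : G.Adj a c) (h3 : G.Adj a d)
    (hbc : ¬ G.Adj b c) (hbd : ¬ G.Adj b d) (nbc : b ≠ c) (nbd : b ≠ d) (ncd : c ≠ d) :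
    G.Adj c d := by
  by_contra h
  exact hcf a b c d ⟨h1, h2, h3, hbc, hbd, h, nbc, nbd, ncd⟩

theorem core_basic (hcf : ClawFree G) {Q1 Q2 P : List V} {a1 b1 a2 b2 p1 p2 u1 u2 : V}
    (hQ1 : Seg G Q1 a1 b2) (hQ2 : Seg G Q2 a2 b1) (hP : Seg G P p1 p2)
    (e1 : G.Adj u1 a1) (e2 : G.Adj b2 u2) (e3 : G.Adj u2 a2) (e4 : G.Adj b1 u1)
    (f1 : G.Adj u1 p1) (f2 : G.Adj p2 u2)
    (nd : (u1 :: Q1 ++ u2 :: Q2 ++ P).Nodup)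
    (HN : ∀ l, CycL G l → l.Perm (u1 :: Q1 ++ u2 :: Q2 ++ P) → False)
    (n1 : ¬ G.Adj p1 a1) (n2 : ¬ G.Adj p1 b1) (n3 : ¬ G.Adj p2 a2) (n4 : ¬ G.Adj p2 b2) :
    G.Adj a1 b1 ∧ G.Adj a2 b2 ∧ ¬ G.Adj a1 u2 ∧ ¬ G.Adj b1 u2 ∧ ¬ G.Adj a2 u1 ∧ ¬ G.Adj b2 u1 := by
  have ma1 := hQ1.left_mem
  have mb2 := hQ1.right_mem
  have ma2 := hQ2.left_mem
  have mb1 := hQ2.right_mem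
  have mp1 := hP.left_mem
  have mp2 := hP.right_mem
  have nd' := nd
  simp only [List.nodup_append, List.nodup_cons, List.cons_append, List.mem_append,
    List.mem_cons, ne_eq] at nd'
  have d1 : a1 ≠ b1 := by grind
  have d2 : a2 ≠ b2 := by grind
  have d3 : p1 ≠ a1 := by grind
  have d4 : p1 ≠ b1 := by grind
  have d5 : p2 ≠ a2 := by grind
  have d6 : p2 ≠ b2 := by grind
  have A1 : G.Adj a1 b1 := claw3 hcf f1 e1 e4.symm n1 n2 d3 d4 d1
  have A2 : G.Adj a2 b2 := claw3 hcf f2.symm e3 e2.symm n3 n4 d5 d6 d2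
  refine ⟨A1, A2, fun h => ?_, fun h => ?_, fun h => ?_, fun h => ?_⟩
  · -- u1 P u2 Q1 Q2
    refine HN ([u1] ++ (P ++ ([u2] ++ (Q1 ++ Q2)))) ⟨_, _, (Seg.single G u1).append (hP.append
      ((Seg.single G u2).append (hQ1.append hQ2 A2.symm) h.symm) f2) f1, e4⟩ ?_
    classical
    rw [List.perm_iff_count]; intro v; simp [List.count_append, List.count_cons]; omega
  · refine HN ([u1] ++ (P ++ ([u2] ++ (Q2.reverse ++ Q1.reverse)))) ⟨_, _, (Seg.single G u1).append
      (hP.append ((Seg.single G u2).append (hQ2.reverse.append hQ1.reverse A2) h.symm) f2) f1,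
      e1.symm⟩ ?_
    classical
    rw [List.perm_iff_count]; intro v; simp [List.count_append, List.count_cons]; omega
  · refine HN ([u2] ++ (P.reverse ++ ([u1] ++ (Q2 ++ Q1)))) ⟨_, _, (Seg.single G u2).append
      (hP.reverse.append ((Seg.single G u1).append (hQ2.append hQ1 A1.symm) h.symm) f1.symm) f2.symm,
      e2⟩ ?_
    classical
    rw [List.perm_iff_count]; intro v; simp [List.count_append, List.count_cons]; omega
  · refine HN ([u2] ++ (P.reverse ++ ([u1] ++ (Q1.reverse ++ Q2.reverse)))) ⟨_, _,
      (Seg.single G u2).append (hP.reverse.append ((Seg.single G u1).append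
      (hQ1.reverse.append hQ2.reverse A1) h.symm) f1.symm) f2.symm, e3.symm⟩ ?_
    classical
    rw [List.perm_iff_count]; intro v; simp [List.count_append, List.count_cons]; omega

theorem core_w1 (hcf : ClawFree G) {Q1 Q2 P : List V} {a1 b1 a2 b2 p1 p2 u1 u2 w : V}
    (hQ1 : Seg G Q1 a1 b2) (hQ2 : Seg G Q2 a2 b1) (hP : Seg G P p1 p2)
    (e1 : G.Adj u1 a1) (e2 : G.Adj b2 u2) (e3 : G.Adj u2 a2) (e4 : G.Adj b1 u1)
    (f1 : G.Adj u1 p1) (f2 : G.Adj p2 u2)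
    (nd : (u1 :: Q1 ++ u2 :: Q2 ++ P).Nodup)
    (HN : ∀ l, CycL G l → l.Perm (u1 :: Q1 ++ u2 :: Q2 ++ P) → False)
    (n1 : ¬ G.Adj p1 a1) (n2 : ¬ G.Adj p1 b1) (n3 : ¬ G.Adj p2 a2) (n4 : ¬ G.Adj p2 b2)
    (hw : w ∈ Q1) (w1 : G.Adj u1 w) (w2 : G.Adj u2 w) (m1 : ¬ G.Adj p1 w) (m2 : ¬ G.Adj p2 w) :
    False := by
  obtain ⟨A1, A2, k1, k2, k3, k4⟩ :=
    core_basic hcf hQ1 hQ2 hP e1 e2 e3 e4 f1 f2 nd HN n1 n2 n3 n4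
  obtain ⟨A, B, rfl⟩ := List.append_of_mem hw
  have wa1 : w ≠ a1 := by rintro rfl; exact k1 w2.symm
  have wb2 : w ≠ b2 := by rintro rfl; exact k4 w1.symm
  have hA : A ≠ [] := by
    rintro rfl
    have := hQ1.2.1
    simp at this; exact wa1 this
  have hB : B ≠ [] := by
    rintro rfl
    have := hQ1.2.2
    simp at this; exact wb2 this
  have ma2 := hQ2.left_mem
  have mb1 := hQ2.right_mem
  have mp1 := hP.left_mem
  have mp2 := hP.right_mem
  have ma1 := hQ1.left_mem
  have mb2 := hQ1.right_mem
  obtain ⟨wm, w', sA, s', ew⟩ := hQ1.split hA (by simp)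
  obtain ⟨rfl, wp, sB, ew'⟩ := s'.split_cons hB
  have mwm := sA.right_mem
  have mwp := sB.left_mem
  have nd' := nd
  simp only [List.nodup_append, List.nodup_cons, List.cons_append, List.mem_append,
    List.mem_cons, ne_eq] at nd' ma1 mb2
  have wA1 : G.Adj w a1 := claw3 hcf f1 w1 e1 m1 n1 (by grind) (by grind) wa1
  have wB1 : G.Adj w b1 := claw3 hcf f1 w1 e4.symm m1 n2 (by grind) (by grind) (by grind)
  have wA2 : G.Adj w a2 := claw3 hcf f2.symm w2 e3 m2 n3 (by grind) (by grind) (by grind)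
  have wB2 : G.Adj w b2 := claw3 hcf f2.symm w2 e2.symm m2 n4 (by grind) (by grind) wb2
  have du1m : u1 ≠ wm := by grind
  have du1p : u1 ≠ wp := by grind
  have du2m : u2 ≠ wm := by grind
  have du2p : u2 ≠ wp := by grind
  have dmp : wm ≠ wp := by grind
  have x1 : ¬ G.Adj wm wp := by
    intro h
    refine HN ([u1] ++ (P ++ ([u2] ++ (B.reverse ++ (A.reverse ++ ([w] ++ Q2)))))) ⟨_, _,
      (Seg.single G u1).append (hP.append ((Seg.single G u2).append (sB.reverse.append
      (sA.reverse.append ((Seg.single G w).append hQ2 wA2) wA1.symm) h.symm) e2.symm) f2) f1, e4⟩ ?_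
    classical
    rw [List.perm_iff_count]; intro v; simp [List.count_append, List.count_cons]; omega
  have x2 : ¬ G.Adj u1 wp := by
    intro h
    refine HN ([u1] ++ (P ++ ([u2] ++ ([w] ++ (A.reverse ++ (Q2.reverse ++ B.reverse)))))) ⟨_, _,
      (Seg.single G u1).append (hP.append ((Seg.single G u2).append ((Seg.single G w).append
      (sA.reverse.append (hQ2.reverse.append sB.reverse A2) A1) ew.symm) w2) f2) f1, h.symm⟩ ?_
    classical
    rw [List.perm_iff_count]; intro v; simp [List.count_append, List.count_cons]; omega
  have x3 : ¬ G.Adj u2 wm := by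
    intro h
    refine HN ([u2] ++ (P.reverse ++ ([u1] ++ ([w] ++ (B ++ (Q2 ++ A)))))) ⟨_, _,
      (Seg.single G u2).append (hP.reverse.append ((Seg.single G u1).append ((Seg.single G w).append
      (sB.append (hQ2.append sA A1.symm) A2.symm) ew') w1) f1.symm) f2.symm, h.symm⟩ ?_
    classical
    rw [List.perm_iff_count]; intro v; simp [List.count_append, List.count_cons]; omega
  have y1 : G.Adj u1 wm := by
    by_contra h
    exact hcf w u1 wm wp ⟨w1.symm, ew.symm, ew', h, x2, x1, du1m, du1p, dmp⟩
  have y2 : G.Adj u2 wp := by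
    by_contra h
    exact hcf w u2 wm wp ⟨w2.symm, ew.symm, ew', x3, h, x1, du2m, du2p, dmp⟩
  refine HN ([u1] ++ (P ++ ([u2] ++ (B ++ (Q2 ++ ([w] ++ A)))))) ⟨_, _,
      (Seg.single G u1).append (hP.append ((Seg.single G u2).append (sB.append (hQ2.append
      ((Seg.single G w).append sA wA1) wB1.symm) A2.symm) y2) f2) f1, y1.symm⟩ ?_
  classical
  rw [List.perm_iff_count]; intro v; simp [List.count_append, List.count_cons]; omega

theorem core_w (hcf : ClawFree G) {Q1 Q2 P : List V} {a1 b1 a2 b2 p1 p2 u1 u2 w : V}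
    (hQ1 : Seg G Q1 a1 b2) (hQ2 : Seg G Q2 a2 b1) (hP : Seg G P p1 p2)
    (e1 : G.Adj u1 a1) (e2 : G.Adj b2 u2) (e3 : G.Adj u2 a2) (e4 : G.Adj b1 u1)
    (f1 : G.Adj u1 p1) (f2 : G.Adj p2 u2)
    (nd : (u1 :: Q1 ++ u2 :: Q2 ++ P).Nodup)
    (HN : ∀ l, CycL G l → l.Perm (u1 :: Q1 ++ u2 :: Q2 ++ P) → False)
    (n1 : ¬ G.Adj p1 a1) (n2 : ¬ G.Adj p1 b1) (n3 : ¬ G.Adj p2 a2) (n4 : ¬ G.Adj p2 b2)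
    (hw : w ∈ Q1 ∨ w ∈ Q2) (w1 : G.Adj u1 w) (w2 : G.Adj u2 w) (m1 : ¬ G.Adj p1 w)
    (m2 : ¬ G.Adj p2 w) : False := by
  have hp : (u2 :: Q2 ++ u1 :: Q1 ++ P.reverse).Perm (u1 :: Q1 ++ u2 :: Q2 ++ P) := by
    classical
    rw [List.perm_iff_count]; intro v; simp [List.count_append, List.count_cons]; omega
  rcases hw with hw | hw
  · exact core_w1 hcf hQ1 hQ2 hP e1 e2 e3 e4 f1 f2 nd HN n1 n2 n3 n4 hw w1 w2 m1 m2
  · exact core_w1 hcf hQ2 hQ1 hP.reverse e3 e4 e1 e2 f2.symm f1.symm (hp.nodup_iff.2 nd)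
      (fun l h h' => HN l h (h'.trans hp)) n3 n4 n1 n2 hw w2 w1 m2 m1

end Adh

namespace Adh

variable {V : Type*} {G : SimpleGraph V}

/-- Deleting `x` leaves a graph with a spanning cycle list. -/
def TypeI (G : SimpleGraph V) (x : V) : Prop :=
  ∃ l, CycL G l ∧ l.Nodup ∧ ∀ v, v ∈ l ↔ v ≠ x

/-- There is a spanning cycle list. -/
def HamL (G : SimpleGraph V) : Prop := ∃ l, CycL G l ∧ l.Nodup ∧ ∀ v, v ∈ l

/-- Decomposition of a cycle missing just `x` with respect to two neighbours of `x`. -/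
structure Pair (G : SimpleGraph V) (x u1 u2 : V) where
  Q1 : List V
  Q2 : List V
  a1 : V
  b1 : V
  a2 : V
  b2 : V
  hQ1 : Seg G Q1 a1 b2
  hQ2 : Seg G Q2 a2 b1
  e1 : G.Adj u1 a1
  e2 : G.Adj b2 u2
  e3 : G.Adj u2 a2
  e4 : G.Adj b1 u1
  nd : (u1 :: Q1 ++ u2 :: Q2 ++ [x]).Nodup
  all : ∀ v, v ∈ (u1 :: Q1 ++ u2 :: Q2 ++ [x])
  HN : ∀ l, CycL G l → l.Perm (u1 :: Q1 ++ u2 :: Q2 ++ [x]) → False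
  n1 : ¬ G.Adj x a1
  n2 : ¬ G.Adj x b1
  n3 : ¬ G.Adj x a2
  n4 : ¬ G.Adj x b2
  A1 : G.Adj a1 b1
  A2 : G.Adj a2 b2
  k1 : ¬ G.Adj a1 u2
  k2 : ¬ G.Adj b1 u2
  k3 : ¬ G.Adj a2 u1
  k4 : ¬ G.Adj b2 u1

theorem pair_of_list (hcf : ClawFree G) (nh : ¬ HamL G) {x u1 u2 : V} {Q1 Q2 : List V}
    (hc : CycL G (u1 :: (Q1 ++ u2 :: Q2))) (nd : (u1 :: (Q1 ++ u2 :: Q2)).Nodup)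
    (hl : ∀ v, v ∈ u1 :: (Q1 ++ u2 :: Q2) ↔ v ≠ x)
    (h1 : G.Adj x u1) (h2 : G.Adj x u2) : ∃ p : Pair G x u1 u2, p.Q1 = Q1 ∧ p.Q2 = Q2 := by
  -- no spanning path of `G - x` joins two neighbours of `x`
  have key : ∀ m a b, Seg G m a b → G.Adj x a → G.Adj x b →
      m.Perm (u1 :: (Q1 ++ u2 :: Q2)) → False := by
    intro m a b hm ha hb hp
    have nm : x ∉ m := by rw [hp.mem_iff, hl]; simp
    refine nh ⟨m ++ [x], ⟨a, x, hm.append (Seg.single G x) hb.symm, ha⟩, ?_, ?_⟩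
    · rw [List.nodup_append]
      refine ⟨hp.nodup_iff.2 nd, by simp, ?_⟩
      intro p hp q hq
      simp at hq; subst hq; rintro rfl; exact nm hp
    · intro v
      by_cases hv : v = x
      · simp [hv]
      · have := (hl v).2 hv
        rw [← hp.mem_iff] at this
        simp [this]
  obtain ⟨z, b1, hs, e4⟩ := hc
  obtain ⟨rfl, a1, hs1, e1⟩ := hs.split_cons (by simp)
  have q1 : Q1 ≠ [] := by
    rintro rfl
    have : a1 = u2 := by have := hs1.2.1; simp at this; exact this.symm
    subst this
    refine key (([] ++ a1 :: Q2) ++ [u1]) _ _ (hs1.append (Seg.single G u1) e4) h2 h1 ?_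
    classical
    rw [List.perm_iff_count]; intro v; simp [List.count_append, List.count_cons]; omega
  obtain ⟨b2, u2', hQ1, hs2, e2⟩ := hs1.split q1 (by simp)
  have q2 : Q2 ≠ [] := by
    rintro rfl
    obtain ⟨rfl, rfl⟩ := hs2.single_eq
    exact key _ _ _ hs h1 h2 (List.Perm.refl _)
  obtain ⟨rfl, a2, hQ2, e3⟩ := hs2.split_cons q2
  have n1 : ¬ G.Adj x a1 := by
    intro h
    refine key ((Q1 ++ u2 :: Q2) ++ [u1]) _ _ (hs1.append (Seg.single G u1) e4) h h1 ?_
    classical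
    rw [List.perm_iff_count]; intro v; simp [List.count_append, List.count_cons]; omega
  have n2 : ¬ G.Adj x b1 := fun h => key _ _ _ hs h1 h (List.Perm.refl _)
  have n3 : ¬ G.Adj x a2 := by
    intro h
    refine key (Q2 ++ ([u1] ++ (Q1 ++ [u2]))) _ _ (hQ2.append ((Seg.single G u1).append
      (hQ1.append (Seg.single G u2) e2) e1) e4) h h2 ?_
    classical
    rw [List.perm_iff_count]; intro v; simp [List.count_append, List.count_cons]; omega
  have n4 : ¬ G.Adj x b2 := by
    intro h
    refine key ([u2] ++ (Q2 ++ ([u1] ++ Q1))) _ _ ((Seg.single G u2).append (hQ2.append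
      ((Seg.single G u1).append hQ1 e1) e4) e3) h2 h ?_
    classical
    rw [List.perm_iff_count]; intro v; simp [List.count_append, List.count_cons]; omega
  have all : ∀ v, v ∈ (u1 :: Q1 ++ u2 :: Q2 ++ [x]) := by
    intro v
    by_cases hv : v = x
    · simp [hv]
    · have := (hl v).2 hv
      simp only [List.mem_append, List.mem_cons] at this ⊢
      tauto
  have nd2 : (u1 :: Q1 ++ u2 :: Q2 ++ [x]).Nodup := by
    rw [List.nodup_append]
    refine ⟨nd, by simp, ?_⟩
    intro p hp q hq
    simp at hq; subst hq
    exact (hl p).1 hp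
  have HN : ∀ l, CycL G l → l.Perm (u1 :: Q1 ++ u2 :: Q2 ++ [x]) → False := by
    intro l h hp
    exact nh ⟨l, h, hp.nodup_iff.2 nd2, fun v => hp.mem_iff.2 (all v)⟩
  obtain ⟨A1, A2, k1, k2, k3, k4⟩ := core_basic hcf hQ1 hQ2 (Seg.single G x) e1 e2 e3 e4 h1.symm h2
    nd2 HN n1 n2 n3 n4
  exact ⟨⟨Q1, Q2, a1, b1, a2, b2, hQ1, hQ2, e1, e2, e3, e4, nd2, all, HN, n1, n2, n3, n4, A1, A2,
    k1, k2, k3, k4⟩, rfl, rfl⟩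

theorem typeI_pair (hcf : ClawFree G) (nh : ¬ HamL G) {x u1 u2 : V} (hx : TypeI G x)
    (h1 : G.Adj x u1) (h2 : G.Adj x u2) (h12 : u1 ≠ u2) : Nonempty (Pair G x u1 u2) := by
  obtain ⟨l, hc, nd, hl⟩ := hx
  obtain ⟨A, B, rfl⟩ := List.append_of_mem ((hl u1).2 h1.ne')
  have hp0 : (A ++ u1 :: B).Perm (u1 :: (B ++ A)) := by
    classical
    rw [List.perm_iff_count]; intro v; simp [List.count_append, List.count_cons]; omega
  have hc := hc.rot
  rw [List.cons_append] at hc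
  have nd := hp0.nodup_iff.1 nd
  have hl : ∀ v, v ∈ u1 :: (B ++ A) ↔ v ≠ x := fun v => by rw [← hl v, hp0.mem_iff]
  have : u2 ∈ B ++ A := by
    have := (hl u2).2 h2.ne'
    rcases List.mem_cons.1 this with h | h
    · exact absurd h.symm h12
    · exact h
  obtain ⟨Q1, Q2, hQ⟩ := List.append_of_mem this
  rw [hQ] at hc nd hl
  obtain ⟨p, -, -⟩ := pair_of_list hcf nh hc nd hl h1 h2
  exact ⟨p⟩

/-- common neighbours of two neighbours of `x` are adjacent to `x` -/
theorem typeI_common (hcf : ClawFree G) (nh : ¬ HamL G) {x u1 u2 w : V} (hx : TypeI G x)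
    (h1 : G.Adj x u1) (h2 : G.Adj x u2) (h12 : u1 ≠ u2) (w1 : G.Adj u1 w) (w2 : G.Adj u2 w)
    (wx : w ≠ x) : G.Adj x w := by
  by_contra hn
  obtain ⟨p⟩ := typeI_pair hcf nh hx h1 h2 h12
  refine core_w hcf p.hQ1 p.hQ2 (Seg.single G x) p.e1 p.e2 p.e3 p.e4 h1.symm h2 p.nd p.HN p.n1 p.n2
    p.n3 p.n4 ?_ w1 w2 hn hn
  have := p.all w
  simp only [List.mem_append, List.mem_cons, List.not_mem_nil] at this
  have := w1.ne'
  have := w2.ne'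
  tauto

theorem typeI_closed (hcf : ClawFree G) (nh : ¬ HamL G) {x u1 u2 w : V} (hx : TypeI G x)
    (h1 : G.Adj x u1) (h2 : G.Adj x u2) (h12 : u1 ≠ u2) (w1 : G.Adj u1 w) (w2 : G.Adj u2 w)
    (wx : G.Adj x w) : G.Adj u1 u2 := by
  by_contra hn
  obtain ⟨p⟩ := typeI_pair hcf nh hx wx h1 w1.ne'
  have k : ¬ G.Adj p.a1 u2 := by
    intro h
    have := typeI_common hcf nh hx wx h2 w2.ne' p.e1 h.symm (by
      rintro h; have := p.hQ1.left_mem; have nd := p.nd; rw [h] at this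
      simp only [List.nodup_append, List.nodup_cons, List.cons_append, List.mem_append,
        List.mem_cons, ne_eq] at nd
      grind)
    exact p.n1 this
  have d1 : p.a1 ≠ u1 := by intro h; exact p.n1 (by rw [h]; exact h1)
  have d2 : p.a1 ≠ u2 := by intro h; exact p.n1 (by rw [h]; exact h2)
  exact hcf w p.a1 u1 u2 ⟨p.e1, w1.symm, w2.symm, p.k1, k, hn, d1, d2, h12⟩

end Adh

namespace Adh

universe u
variable {V : Type u} {G : SimpleGraph V}

/-- reachability inside `s` -/
def Rch (G : SimpleGraph V) (s : Set V) : V → V → Prop :=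
  Relation.ReflTransGen (fun a b => G.Adj a b ∧ a ∈ s ∧ b ∈ s)

/-- `s` is connected -/
def Cn (G : SimpleGraph V) (s : Set V) : Prop := ∀ x ∈ s, ∀ y ∈ s, Rch G s x y

/-- walk of given length with all vertices but the first one in `s` -/
def Wk (G : SimpleGraph V) (s : Set V) : ℕ → V → V → Prop
  | 0, x, y => x = y
  | n + 1, x, y => ∃ z ∈ s, G.Adj x z ∧ Wk G s n z y

/-- working version of almost distance-hereditary -/
def ADH (G : SimpleGraph V) : Prop :=
  ∀ s, Cn G s → ∀ x ∈ s, ∀ y ∈ s, ∀ k, Wk G Set.univ k x y → ∃ j ≤ k + 1, Wk G s j x y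

/-- working version of 2-connected -/
def TC (G : SimpleGraph V) (S : Set V) : Prop := 3 ≤ S.ncard ∧ ∀ v ∈ S, Cn G (S \ {v})

lemma Rch.refl {s : Set V} (x : V) : Rch G s x x := Relation.ReflTransGen.refl

lemma Rch.trans {s : Set V} {x y z : V} (h : Rch G s x y) (h' : Rch G s y z) : Rch G s x z :=
  Relation.ReflTransGen.trans h h'

lemma Rch.of_adj {s : Set V} {x y : V} (h : G.Adj x y) (hx : x ∈ s) (hy : y ∈ s) : Rch G s x y :=
  Relation.ReflTransGen.single ⟨h, hx, hy⟩

lemma Rch.symm {s : Set V} {x y : V} (h : Rch G s x y) : Rch G s y x := by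
  induction h with
  | refl => exact Rch.refl _
  | tail _ h2 ih => exact (Rch.of_adj h2.1.symm h2.2.2 h2.2.1).trans ih

lemma Rch.mono {s t : Set V} (hst : s ⊆ t) {x y : V} (h : Rch G s x y) : Rch G t x y := by
  induction h with
  | refl => exact Rch.refl _
  | tail _ h2 ih => exact ih.trans (Rch.of_adj h2.1 (hst h2.2.1) (hst h2.2.2))

lemma cn_of_hub {s : Set V} (c : V) (h : ∀ x ∈ s, Rch G s x c) : Cn G s :=
  fun x hx y hy => (h x hx).trans (h y hy).symm

lemma rch_of_walk (s : Set V) : ∀ (x y : s), (G.induce s).Walk x y → Rch G s x y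
  | _, _, .nil => Rch.refl _
  | x, y, .cons (v := z) h p => by
    have h' : G.Adj x z := h
    exact (Rch.of_adj h' x.2 z.2).trans (rch_of_walk s z y p)

lemma wk_of_walk (s : Set V) : ∀ (x y : s) (p : (G.induce s).Walk x y), Wk G s p.length x y
  | _, _, .nil => rfl
  | x, y, .cons (v := z) h p => ⟨z, z.2, h, wk_of_walk s z y p⟩

lemma walk_of_wk (s : Set V) : ∀ (k : ℕ) (x y : V), Wk G s k x y → ∃ p : G.Walk x y, p.length = k
  | 0, x, y, h => by
    have h : x = y := h
    subst h; exact ⟨.nil, rfl⟩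
  | k + 1, x, y, ⟨z, _, h, hz⟩ => by
    obtain ⟨p, hp⟩ := walk_of_wk s k z y hz
    exact ⟨.cons h p, by simp [hp]⟩

lemma reach_of_rch (s : Set V) {x y : V} (hx : x ∈ s) (h : Rch G s x y) :
    ∃ hy : y ∈ s, (G.induce s).Reachable ⟨x, hx⟩ ⟨y, hy⟩ := by
  induction h with
  | refl => exact ⟨hx, .refl _⟩
  | tail _ h2 ih =>
    obtain ⟨hb, ih⟩ := ih
    refine ⟨h2.2.2, ih.trans (SimpleGraph.Adj.reachable ?_)⟩
    exact h2.1

theorem adh_of (h : AlmostDH G) : ADH G := by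
  intro s hs x hx y hy k hk
  have hc : (G.induce s).Connected := by
    have : Nonempty s := ⟨⟨x, hx⟩⟩
    refine ⟨fun a b => ?_⟩
    exact (reach_of_rch s a.2 (hs a a.2 b b.2)).2
  obtain ⟨p, hp⟩ := walk_of_wk _ _ _ _ hk
  have h1 := h s hc ⟨x, hx⟩ ⟨y, hy⟩
  have h2 := SimpleGraph.dist_le p
  obtain ⟨q, hq⟩ := hc.exists_walk_length_eq_dist ⟨x, hx⟩ ⟨y, hy⟩
  exact ⟨q.length, by simp only [] at h1; omega, wk_of_walk s _ _ q⟩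

theorem tc_of [Fintype V] (h3 : 3 ≤ Fintype.card V) (h : ∀ v : V, (G.induce {v}ᶜ).Connected) :
    TC G Set.univ := by
  refine ⟨by rw [Set.ncard_univ, Nat.card_eq_fintype_card]; exact h3, ?_⟩
  intro v _ x hx y hy
  have e : (Set.univ \ {v} : Set V) = {v}ᶜ := by ext; simp
  rw [e] at hx hy ⊢
  obtain ⟨p⟩ := (h v).preconnected ⟨x, hx⟩ ⟨y, hy⟩
  exact rch_of_walk _ _ _ p

/-! transfer to induced subgraphs -/

lemma rch_image {S : Set V} {t : Set S} {x y : S} (h : Rch (G.induce S) t x y) :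
    Rch G (Subtype.val '' t) x y := by
  induction h with
  | refl => exact Rch.refl _
  | tail _ h2 ih =>
    exact ih.trans (Rch.of_adj h2.1 (Set.mem_image_of_mem _ h2.2.1) (Set.mem_image_of_mem _ h2.2.2))

lemma rch_preimage {S : Set V} {t : Set S} {x : S} {y : V} (hx : x ∈ t)
    (h : Rch G (Subtype.val '' t) x y) :
    ∃ hy : y ∈ S, (⟨y, hy⟩ : S) ∈ t ∧ Rch (G.induce S) t x ⟨y, hy⟩ := by
  induction h with
  | refl => exact ⟨x.2, hx, Rch.refl _⟩
  | tail _ h2 ih =>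
    obtain ⟨h, hm, ih⟩ := ih
    obtain ⟨⟨c, hc⟩, hct, rfl⟩ := h2.2.2
    exact ⟨hc, hct, ih.trans (Rch.of_adj h2.1 hm hct)⟩

lemma wk_univ_val {S : Set V} : ∀ (k : ℕ) (x y : S), Wk (G.induce S) Set.univ k x y →
    Wk G Set.univ k x y
  | 0, _, _, h => congrArg Subtype.val h
  | k + 1, _, y, ⟨z, _, h, hz⟩ => ⟨z, trivial, h, wk_univ_val k z y hz⟩

lemma wk_preimage {S : Set V} {t : Set S} : ∀ (k : ℕ) (x y : S), Wk G (Subtype.val '' t) k x y →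
    Wk (G.induce S) t k x y
  | 0, _, _, h => Subtype.ext h
  | k + 1, _, y, ⟨_, ⟨z, hzt, rfl⟩, h, hz⟩ => ⟨z, hzt, h, wk_preimage k z y hz⟩

theorem ADH.induce (h : ADH G) (S : Set V) : ADH (G.induce S) := by
  intro t ht x hx y hy k hk
  obtain ⟨j, hj, hw⟩ := h (Subtype.val '' t) (by
    rintro _ ⟨a, ha, rfl⟩ _ ⟨b, hb, rfl⟩
    exact rch_image (ht a ha b hb)) x (Set.mem_image_of_mem _ hx) y (Set.mem_image_of_mem _ hy) k
    (wk_univ_val k x y hk)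
  exact ⟨j, hj, wk_preimage j x y hw⟩

theorem TC.induce {S : Set V} (h : TC G S) : TC (G.induce S) Set.univ := by
  refine ⟨by rw [Set.ncard_univ, Nat.card_coe_set_eq]; exact h.1, ?_⟩
  intro v _ x hx y hy
  have e : Subtype.val '' (Set.univ \ {v} : Set S) = S \ {(v : V)} := by
    ext w; simp only [Set.mem_image, Set.mem_sdiff, Set.mem_univ, true_and, Set.mem_singleton_iff]
    constructor
    · rintro ⟨a, ha, rfl⟩
      exact ⟨a.2, fun h => ha (Subtype.ext h)⟩
    · rintro ⟨h1, h2⟩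
      exact ⟨⟨w, h1⟩, fun h => h2 (congrArg Subtype.val h), rfl⟩
  have := h.2 v v.2 x ⟨x.2, fun h => hx.2 (Subtype.ext h)⟩ y ⟨y.2, fun h => hy.2 (Subtype.ext h)⟩
  rw [← e] at this
  exact (rch_preimage hx this).2.2

theorem ClawFree_induce (h : ClawFree G) (S : Set V) : ClawFree (G.induce S) := by
  rintro a b c d ⟨h1, h2, h3, h4, h5, h6, h7, h8, h9⟩
  exact h a b c d ⟨h1, h2, h3, h4, h5, h6, fun h => h7 (Subtype.ext h), fun h => h8 (Subtype.ext h),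
    fun h => h9 (Subtype.ext h)⟩

/-- there is a cycle list with vertex set `S` -/
def CycOn (G : SimpleGraph V) (S : Set V) : Prop := ∃ l, CycL G l ∧ l.Nodup ∧ ∀ v, v ∈ l ↔ v ∈ S

theorem cycOn_of_induce {S : Set V} (h : HamL (G.induce S)) : CycOn G S := by
  obtain ⟨l, ⟨a, b, ⟨h1, h2, h3⟩, e⟩, nd, hl⟩ := h
  refine ⟨l.map Subtype.val, ⟨a, b, ⟨?_, by rw [List.head?_map, h2]; rfl,
    by rw [List.getLast?_map, h3]; rfl⟩, e⟩,
    nd.map Subtype.val_injective, ?_⟩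
  · rw [List.isChain_map]; exact h1
  · intro v; simp [hl]

/-- from a spanning cycle list to Mathlib's notion -/
theorem isHamiltonian_of_hamL {W : Type*} [Fintype W] [DecidableEq W] {G : SimpleGraph W}
    (h3 : 3 ≤ Fintype.card W) (h : HamL G) : G.IsHamiltonian := by
  intro _
  obtain ⟨l, ⟨a, b, hs, e⟩, nd, hl⟩ := h
  have key : ∀ (l : List W) (hne : l ≠ []) (hc : l.IsChain G.Adj), ∀ a b, l.head? = some a →
      l.getLast? = some b → ∃ p : G.Walk a b, p.support = l := by
    intro l hne hc a b ha hb
    have e1 : l.head hne = a := by rw [List.head?_eq_some_head hne] at ha; simpa using ha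
    have e2 : l.getLast hne = b := by rw [List.getLast?_eq_some_getLast hne] at hb; simpa using hb
    subst e1; subst e2
    exact ⟨SimpleGraph.Walk.ofSupport l hne hc, SimpleGraph.Walk.support_ofSupport hne hc⟩
  obtain ⟨p, hp⟩ := key l hs.ne_nil hs.1 a b hs.2.1 hs.2.2
  have hP : p.IsPath := SimpleGraph.Walk.IsPath.mk' (by rw [hp]; exact nd)
  have hH : p.IsHamiltonian := hP.isHamiltonian_of_mem (by intro w; rw [hp]; exact hl w)
  refine ⟨b, SimpleGraph.Walk.cons e p, ?_⟩
  have hlen := hH.length_eq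
  refine ⟨?_, ?_⟩
  · rw [SimpleGraph.Walk.isCycle_iff_isPath_tail_and_le_length]
    refine ⟨by simpa using hP, by simp; omega⟩
  · intro w
    simpa using hH w

/-- extraction of a path list -/
lemma exists_path {s : Set V} {x y : V} (hx : x ∈ s) (h : Rch G s x y) :
    ∃ l, Seg G l x y ∧ l.Nodup ∧ ∀ v ∈ l, v ∈ s := by
  induction h with
  | refl => exact ⟨[x], Seg.single G x, by simp, by simpa using hx⟩
  | @tail b c _ h2 ih =>
    obtain ⟨l, hs, nd, hl⟩ := ih
    by_cases hc : c ∈ l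
    · obtain ⟨A, B, rfl⟩ := List.append_of_mem hc
      refine ⟨A ++ [c], ?_, ?_, ?_⟩
      · refine ⟨?_, ?_, by simp⟩
        · have := hs.1
          rw [show A ++ c :: B = (A ++ [c]) ++ B by simp] at this
          exact this.left_of_append
        · have := hs.2.1
          cases A <;> simpa using this
      · rw [show A ++ c :: B = (A ++ [c]) ++ B by simp] at nd
        exact (List.nodup_append.1 nd).1
      · intro v hv; apply hl; simp at hv ⊢; tauto
    · refine ⟨l ++ [c], hs.append (Seg.single G c) h2.1, ?_, ?_⟩
      · rw [List.nodup_append]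
        refine ⟨nd, by simp, ?_⟩
        intro p hp q hq; simp at hq; subst hq; rintro rfl; exact hc hp
      · intro v hv
        simp at hv
        rcases hv with hv | rfl
        · exact hl v hv
        · exact h2.2.2

lemma Seg.cn {l : List V} : ∀ {a b : V}, Seg G l a b → ∀ {s : Set V}, (∀ v ∈ l, v ∈ s) →
    ∀ v ∈ l, Rch G s a v := by
  induction l with
  | nil => intro a b h; exact absurd rfl h.ne_nil
  | cons c l ih =>
    intro a b h s hs v hv
    have e : c = a := by simpa using h.2.1
    subst e
    rcases List.mem_cons.1 hv with rfl | hv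
    · exact Rch.refl _
    have hl : l ≠ [] := List.ne_nil_of_mem hv
    obtain ⟨_, d, h1, h2⟩ := h.split_cons hl
    have hs' : ∀ v ∈ l, v ∈ s := fun v hv => hs v (List.mem_cons_of_mem _ hv)
    exact (Rch.of_adj h2 (hs c (by simp)) (hs' d h1.left_mem)).trans (ih h1 hs' v hv)

lemma seg_cn {l : List V} {a b : V} (h : Seg G l a b) {s : Set V} (hs : ∀ v, v ∈ l ↔ v ∈ s) :
    Cn G s := cn_of_hub a (fun x hx => (h.cn (fun v hv => (hs v).1 hv) x ((hs x).2 hx)).symm)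

lemma cyc_tc {l : List V} (h : CycL G l) (nd : l.Nodup) {s : Set V} (hs : ∀ v, v ∈ l ↔ v ∈ s)
    (h3 : 3 ≤ l.length) : TC G s := by
  classical
  have hcard : s.ncard = l.length := by
    have : s = ↑(l.toFinset) := by ext v; simp [hs]
    rw [this, Set.ncard_coe_finset, List.toFinset_card_of_nodup nd]
  refine ⟨by omega, ?_⟩
  intro v hv
  obtain ⟨A, B, rfl⟩ := List.append_of_mem ((hs v).2 hv)
  obtain ⟨a, b, hseg, _⟩ := h.rot
  rw [List.cons_append] at hseg
  have hne : B ++ A ≠ [] := by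
    intro h
    simp at h
    simp [h] at h3
  obtain ⟨_, d, h1, h2⟩ := hseg.split_cons hne
  refine seg_cn h1 ?_
  intro w
  have := hs w
  simp only [List.mem_append, List.mem_cons] at this
  simp only [List.nodup_append, List.nodup_cons, List.mem_cons, ne_eq] at nd
  simp only [List.mem_append, Set.mem_sdiff, Set.mem_singleton_iff, ← this]
  grind

end Adh

namespace Adh

universe u
variable {V : Type u} {G : SimpleGraph V}

lemma TC.cn [Finite V] {S : Set V} (h : TC G S) : Cn G S := by
  intro a ha b hb
  have : ∃ v ∈ S, v ∉ ({a, b} : Set V) := by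
    by_contra hc
    push Not at hc
    have h1 := Set.ncard_le_ncard (show S ⊆ {a, b} from hc) (Set.toFinite _)
    have h2 := Set.ncard_insert_le a {b}
    rw [Set.ncard_singleton] at h2
    have := h.1
    omega
  obtain ⟨v, hv, hn⟩ := this
  simp only [Set.mem_insert_iff, Set.mem_singleton_iff, not_or] at hn
  exact (h.2 v hv a ⟨ha, fun h => hn.1 h.symm⟩ b ⟨hb, fun h => hn.2 h.symm⟩).mono
    Set.sdiff_subset

lemma tc_add [Finite V] {S : Set V} (h : TC G S) {x u1 u2 : V} (hx : x ∉ S) (h1 : u1 ∈ S)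
    (h2 : u2 ∈ S) (h12 : u1 ≠ u2) (e1 : G.Adj x u1) (e2 : G.Adj x u2) : TC G (insert x S) := by
  refine ⟨h.1.trans (Set.ncard_le_ncard (Set.subset_insert _ _) (Set.toFinite _)), ?_⟩
  intro v hv
  rcases Set.mem_insert_iff.1 hv with rfl | hv
  · have : insert v S \ {v} = S := by
      ext w; simp only [Set.mem_sdiff, Set.mem_insert_iff, Set.mem_singleton_iff]
      grind
    rw [this]; exact h.cn
  · have : ∃ u ∈ S, u ≠ v ∧ G.Adj x u := by
      by_cases hu : u1 = v
      · exact ⟨u2, h2, by rintro rfl; exact h12 hu, e2⟩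
      · exact ⟨u1, h1, hu, e1⟩
    obtain ⟨u, hu, huv, e⟩ := this
    have hxv : x ≠ v := by rintro rfl; exact hx hv
    refine cn_of_hub u ?_
    intro y hy
    rcases Set.mem_insert_iff.1 hy.1 with rfl | hy'
    · exact Rch.of_adj e hy ⟨Set.mem_insert_of_mem _ hu, huv⟩
    · refine (h.2 v hv y ⟨hy', hy.2⟩ u ⟨hu, huv⟩).mono ?_
      exact Set.sdiff_subset_sdiff_left (Set.subset_insert _ _)

theorem big_pair (hcf : ClawFree G) {S : Set V} (hC : CycOn G S)
    (hmax : ∀ l, CycL G l → l.Nodup → (∀ v ∈ S, v ∈ l) → (∃ v ∈ l, v ∉ S) → False)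
    {u1 u2 p1 p2 : V} {P : List V} (h1 : u1 ∈ S) (h2 : u2 ∈ S) (h12 : u1 ≠ u2)
    (hP : Seg G P p1 p2) (ndP : P.Nodup) (hPS : ∀ v ∈ P, v ∉ S)
    (f1 : G.Adj u1 p1) (f2 : G.Adj p2 u2)
    (o1 : ∀ s ∈ S, G.Adj p1 s → s = u1) (o2 : ∀ s ∈ S, G.Adj p2 s → s = u2) :
    ¬ G.Adj u1 u2 ∧ ∀ w ∈ S, G.Adj u1 w → G.Adj u2 w → False := by
  obtain ⟨l, hc, nd, hl⟩ := hC
  obtain ⟨A, B, rfl⟩ := List.append_of_mem ((hl u1).2 h1)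
  have hp0 : (A ++ u1 :: B).Perm (u1 :: (B ++ A)) := by
    classical
    rw [List.perm_iff_count]; intro v; simp [List.count_append, List.count_cons]; omega
  have hc := hc.rot
  rw [List.cons_append] at hc
  have nd := hp0.nodup_iff.1 nd
  have hl : ∀ v, v ∈ u1 :: (B ++ A) ↔ v ∈ S := fun v => by rw [← hl v, hp0.mem_iff]
  have : u2 ∈ B ++ A := by
    have := (hl u2).2 h2
    rcases List.mem_cons.1 this with h | h
    · exact absurd h.symm h12
    · exact h
  obtain ⟨Q1, Q2, hQ⟩ := List.append_of_mem this
  rw [hQ] at hc nd hl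
  clear this hQ hp0
  have nd2 : (u1 :: Q1 ++ u2 :: Q2 ++ P).Nodup := by
    rw [List.nodup_append]
    refine ⟨nd, ndP, ?_⟩
    rintro p hp q hq rfl
    exact hPS p hq ((hl p).1 hp)
  have HN : ∀ l, CycL G l → l.Perm (u1 :: Q1 ++ u2 :: Q2 ++ P) → False := by
    intro l h hp
    refine hmax l h (hp.nodup_iff.2 nd2) ?_ ⟨p1, ?_, hPS p1 hP.left_mem⟩
    · intro v hv
      rw [hp.mem_iff, List.mem_append]
      exact Or.inl ((hl v).2 hv)
    · rw [hp.mem_iff, List.mem_append]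
      exact Or.inr hP.left_mem
  obtain ⟨z, b1, hs, e4⟩ := hc
  obtain ⟨rfl, a1, hs1, e1⟩ := hs.split_cons (by simp)
  have q1 : Q1 ≠ [] := by
    rintro rfl
    have : a1 = u2 := by have := hs1.2.1; simp at this; exact this.symm
    subst this
    refine HN ([u1] ++ (P ++ ([] ++ a1 :: Q2))) ⟨_, _, (Seg.single G u1).append
      (hP.append hs1 f2) f1, e4⟩ ?_
    classical
    rw [List.perm_iff_count]; intro v; simp [List.count_append, List.count_cons]; omega
  obtain ⟨b2, u2', hQ1, hs2, e2⟩ := hs1.split q1 (by simp)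
  have q2 : Q2 ≠ [] := by
    rintro rfl
    obtain ⟨rfl, rfl⟩ := hs2.single_eq
    refine HN ((u1 :: (Q1 ++ [u2])) ++ P.reverse) ⟨_, _, hs.append hP.reverse f2.symm, f1.symm⟩ ?_
    classical
    rw [List.perm_iff_count]; intro v; simp [List.count_append, List.count_cons]
  obtain ⟨rfl, a2, hQ2, e3⟩ := hs2.split_cons q2
  have ma1 := hQ1.left_mem
  have mb2 := hQ1.right_mem
  have ma2 := hQ2.left_mem
  have mb1 := hQ2.right_mem
  have hS : ∀ v, v ∈ Q1 ∨ v ∈ Q2 → v ∈ S := by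
    intro v hv; rw [← hl]; simp; tauto
  have d : ∀ v, v ∈ Q1 ∨ v ∈ Q2 → v ≠ u1 ∧ v ≠ u2 := by
    intro v hv
    simp only [List.nodup_cons, List.mem_append, List.mem_cons, List.nodup_append, ne_eq] at nd
    grind
  have n1 : ¬ G.Adj p1 a1 := fun h => (d a1 (.inl ma1)).1 (o1 _ (hS _ (.inl ma1)) h)
  have n2 : ¬ G.Adj p1 b1 := fun h => (d b1 (.inr mb1)).1 (o1 _ (hS _ (.inr mb1)) h)
  have n3 : ¬ G.Adj p2 a2 := fun h => (d a2 (.inr ma2)).2 (o2 _ (hS _ (.inr ma2)) h)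
  have n4 : ¬ G.Adj p2 b2 := fun h => (d b2 (.inl mb2)).2 (o2 _ (hS _ (.inl mb2)) h)
  obtain ⟨A1, A2, k1, k2, k3, k4⟩ := core_basic hcf hQ1 hQ2 hP e1 e2 e3 e4 f1 f2
    nd2 HN n1 n2 n3 n4
  constructor
  · intro h
    have hp1 := hPS p1 hP.left_mem
    exact hcf u1 p1 u2 a1 ⟨f1, h, e1, fun h => h12 (o1 _ h2 h).symm, n1, fun h => k1 h.symm,
      by rintro rfl; exact hp1 h2, by rintro rfl; exact hp1 (hS _ (.inl ma1)),
      (d a1 (.inl ma1)).2.symm⟩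
  · intro w hw w1 w2
    refine core_w hcf hQ1 hQ2 hP e1 e2 e3 e4 f1 f2 nd2 HN n1 n2 n3 n4 ?_ w1 w2
      (fun h => w1.ne' (o1 _ hw h)) (fun h => w2.ne' (o2 _ hw h))
    have := (hl w).2 hw
    simp only [List.mem_append, List.mem_cons] at this
    have := w1.ne'
    have := w2.ne'
    tauto

end Adh

namespace Adh

universe u
variable {V : Type u} {G : SimpleGraph V}

lemma rch_cross {s A : Set V} {a b : V} (h : Rch G s a b) (ha : a ∈ A) (hb : b ∉ A) :
    ∃ c d, G.Adj c d ∧ c ∈ s ∧ d ∈ s ∧ c ∈ A ∧ d ∉ A := by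
  induction h with
  | refl => exact absurd ha hb
  | @tail c d _ h2 ih =>
    by_cases hc : c ∈ A
    · exact ⟨c, d, h2.1, h2.2.1, h2.2.2, hc, hb⟩
    · exact ih hc

lemma exists_third [Finite V] (htc : 3 ≤ (Set.univ : Set V).ncard) (a b : V) :
    ∃ v, v ≠ a ∧ v ≠ b := by
  by_contra hc
  push Not at hc
  have h1 := Set.ncard_le_ncard (show (Set.univ : Set V) ⊆ {a, b} from fun v _ => by
    have := hc v; simp; tauto) (Set.toFinite _)
  have h2 := Set.ncard_insert_le a {b}
  rw [Set.ncard_singleton] at h2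
  omega

lemma exists_two_nbrs [Finite V] (htc : TC G Set.univ) (x : V) :
    ∃ u1 u2, G.Adj x u1 ∧ G.Adj x u2 ∧ u1 ≠ u2 := by
  obtain ⟨v, hv, _⟩ := exists_third htc.1 x x
  obtain ⟨c, d, e, _, _, hc, hd⟩ := rch_cross (A := {x}) (htc.cn x trivial v trivial) rfl hv
  have hc : c = x := hc
  subst hc
  have hd : d ≠ c := hd
  obtain ⟨v, hv1, hv2⟩ := exists_third htc.1 c d
  obtain ⟨c', d', e', _, hd', hc, hd2⟩ := rch_cross (A := {c}) (htc.2 d trivial c ⟨trivial, hd.symm⟩ v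
    ⟨trivial, hv2⟩) rfl hv1
  have hc : c' = c := hc
  subst hc
  exact ⟨d, d', e, e', fun h => hd'.2 h.symm⟩

theorem exists_typeI [Finite V] (hcf : ClawFree G) (hadh : ADH G) (htc : TC G Set.univ)
    (nh : ¬ HamL G) (hmin : ∀ S, S ≠ Set.univ → TC G S → CycOn G S) : ∃ x, TypeI G x := by
  classical
  by_contra hno
  -- a proper 2-connected set exists
  have hex : ∃ S, S ≠ Set.univ ∧ TC G S := by
    obtain ⟨v, -⟩ : (Set.univ : Set V).Nonempty := Set.nonempty_of_ncard_ne_zero (by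
      have := htc.1; omega)
    obtain ⟨u1, u2, e1, e2, h12⟩ := exists_two_nbrs htc v
    obtain ⟨l, hs, nd, hl⟩ := exists_path (s := Set.univ \ {v}) ⟨trivial, e1.ne'⟩
      (htc.2 v trivial u1 ⟨trivial, e1.ne'⟩ u2 ⟨trivial, e2.ne'⟩)
    have hv : v ∉ l := fun h => (hl v h).2 rfl
    have hcyc : CycL G (v :: l) := ⟨v, u2, hs.cons e1, e2.symm⟩
    have ndc : (v :: l).Nodup := List.nodup_cons.2 ⟨hv, nd⟩
    refine ⟨{w | w ∈ v :: l}, ?_, ?_⟩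
    · intro h
      exact nh ⟨v :: l, hcyc, ndc, fun w => by
        have : w ∈ (Set.univ : Set V) := trivial
        rw [← h] at this; exact this⟩
    · refine cyc_tc hcyc ndc (fun _ => Iff.rfl) ?_
      match l, hs with
      | [], hs => exact absurd rfl hs.ne_nil
      | [a], hs =>
        obtain ⟨rfl, h⟩ := hs.single_eq
        exact absurd h h12
      | a :: b :: l, _ => simp
  obtain ⟨S, ⟨hSu, hS⟩, hSmax⟩ := (Set.toFinite {S : Set V | S ≠ Set.univ ∧ TC G S}).exists_maximal
    hex
  have hbig : ∀ T, TC G T → S ⊆ T → T ≠ Set.univ → T ⊆ S := fun T h1 h2 h3 => hSmax ⟨h3, h1⟩ h2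
  have hC := hmin S hSu hS
  have hmax : ∀ l, CycL G l → l.Nodup → (∀ v ∈ S, v ∈ l) → (∃ v ∈ l, v ∉ S) → False := by
    intro l hc nd h1 ⟨v, hv, hvS⟩
    have h3 : 3 ≤ l.length := by
      have e : ({w | w ∈ l} : Set V) = ↑(l.toFinset) := by ext v; simp
      have := Set.ncard_le_ncard (show S ⊆ {w | w ∈ l} from h1) (Set.toFinite _)
      rw [e, Set.ncard_coe_finset, List.toFinset_card_of_nodup nd] at this
      exact hS.1.trans this
    refine hvS (hbig {w | w ∈ l} (cyc_tc hc nd (fun _ => Iff.rfl) h3) h1 ?_ hv)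
    intro h
    exact nh ⟨l, hc, nd, fun w => by
        have : w ∈ (Set.univ : Set V) := trivial
        rw [← h] at this; exact this⟩
  have hone : ∀ x, x ∉ S → ∀ u1 ∈ S, ∀ u2 ∈ S, G.Adj x u1 → G.Adj x u2 → u1 = u2 := by
    intro x hx u1 h1 u2 h2 e1 e2
    by_contra h12
    have ht := tc_add hS hx h1 h2 h12 e1 e2
    by_cases hu : insert x S = Set.univ
    · obtain ⟨l, hc, nd, hl⟩ := hC
      refine hno ⟨x, l, hc, nd, fun v => ?_⟩
      rw [hl]
      constructor
      · rintro h rfl; exact hx h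
      · intro h
        have : v ∈ (Set.univ : Set V) := trivial
        rw [← hu] at this
        exact this.resolve_left h
    · exact hx (hbig _ ht (Set.subset_insert _ _) hu (Set.mem_insert _ _))
  obtain ⟨s1, hs1⟩ : S.Nonempty := Set.nonempty_of_ncard_ne_zero (by have := hS.1; omega)
  obtain ⟨t1, ht1⟩ := (Set.ne_univ_iff_exists_notMem S).1 hSu
  obtain ⟨u2, y, e2, _, _, h2, hy⟩ := rch_cross (htc.cn s1 trivial t1 trivial) hs1 ht1
  obtain ⟨s0, hs0, hs02⟩ := Set.exists_ne_of_one_lt_ncard (s := S) (by have := hS.1; omega) u2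
  have hr := htc.2 u2 trivial s0 ⟨trivial, hs02⟩ y ⟨trivial, e2.ne'⟩
  let TT : V → Prop := fun v => ∃ T : Set V, v ∈ T ∧ (∀ t ∈ T, t ∉ S ∧ ¬ G.Adj t u2) ∧ Cn G (S ∪ T)
  have hstep : ∀ v, Rch G (Set.univ \ {u2}) s0 v → v ∈ S ∨ TT v ∨
      ∃ x' y', y' ∉ S ∧ G.Adj x' y' ∧ G.Adj y' u2 ∧ TT x' := by
    intro v hv
    induction hv with
    | refl => exact Or.inl hs0
    | @tail b c _ hbc ih =>
      by_cases hcS : c ∈ S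
      · exact Or.inl hcS
      rcases ih with hb | ⟨T, hbT, hT, hcn⟩ | hd
      · right; left
        refine ⟨{c}, rfl, ?_, ?_⟩
        · rintro t rfl
          exact ⟨hcS, fun h => hbc.2.1.2 (hone t hcS b hb u2 h2 hbc.1.symm h)⟩
        · refine cn_of_hub b ?_
          rintro w (hw | rfl)
          · exact (hS.cn w hw b hb).mono Set.subset_union_left
          · exact Rch.of_adj hbc.1.symm (Or.inr rfl) (Or.inl hb)
      · by_cases hcu : G.Adj c u2
        · exact Or.inr (Or.inr ⟨b, c, hcS, hbc.1, hcu, T, hbT, hT, hcn⟩)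
        · right; left
          refine ⟨insert c T, Set.mem_insert _ _, ?_, ?_⟩
          · rintro t (rfl | ht)
            · exact ⟨hcS, hcu⟩
            · exact hT t ht
          · have hsub : S ∪ T ⊆ S ∪ insert c T :=
              Set.union_subset_union_right _ (Set.subset_insert _ _)
            have hbm : b ∈ S ∪ T := Or.inr hbT
            refine cn_of_hub b ?_
            rintro w (hw | rfl | hw)
            · exact (hcn w (Or.inl hw) b hbm).mono hsub
            · exact Rch.of_adj hbc.1.symm (Or.inr (Or.inl rfl)) (hsub hbm)
            · exact (hcn w (Or.inr hw) b hbm).mono hsub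
      · exact Or.inr (Or.inr hd)
  rcases hstep y hr with h | ⟨T, hyT, hT, _⟩ | ⟨x', y', hy', exy, eyu, T, hxT, hT, hcn⟩
  · exact hy h
  · exact (hT y hyT).2 e2.symm
  obtain ⟨hxS, hxu⟩ := hT x' hxT
  have hon : ∀ x, x ∉ S → ∀ u ∈ S, G.Adj x u → ∀ s ∈ S, G.Adj x s → s = u :=
    fun x hx u hu e s hs e' => hone x hx s hs u hu e' e
  have pair2 : ∀ z ∈ S, G.Adj x' z → z ≠ u2 → ¬ G.Adj z u2 ∧
      ∀ w ∈ S, G.Adj z w → G.Adj u2 w → False := by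
    intro z hz e hzu
    refine big_pair hcf hC hmax (P := [x', y']) (p1 := x') (p2 := y') hz h2 hzu
      ((Seg.single G y').cons exy) (by simp [exy.ne]) (by simp [hxS, hy']) e.symm eyu
      (hon x' hxS z hz e) (hon y' hy' u2 h2 eyu)
  obtain ⟨j, hj, hw⟩ := hadh (S ∪ T) hcn x' (Or.inr hxT) u2 (Or.inl h2) 2
    ⟨y', trivial, exy, u2, trivial, eyu, rfl⟩
  have hqS : ∀ q ∈ S ∪ T, G.Adj q u2 → q ∈ S := by
    rintro q (h | h) e
    · exact h
    · exact absurd e (hT q h).2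
  match j, hj, hw with
  | 0, _, hw =>
    have hw : x' = u2 := hw
    exact hxS (hw ▸ h2)
  | 1, _, ⟨z, _, e, hz⟩ =>
    have hz : z = u2 := hz
    exact hxu (hz ▸ e)
  | 2, _, ⟨q, hq, e, z, _, e', hz⟩ =>
    have hz : z = u2 := hz
    subst hz
    exact (pair2 q (hqS q hq e') e e'.ne).1 e'
  | 3, _, ⟨p, hp, e, q, hq, e', z, _, e'', hz⟩ =>
    have hz : z = u2 := hz
    subst hz
    have hqS := hqS q hq e''
    rcases hp with hp | hp
    · exact (pair2 p hp e (by rintro rfl; exact hxu e)).2 q hqS e' e''.symm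
    · obtain ⟨hpS, hpu⟩ := hT p hp
      refine (big_pair hcf hC hmax (P := [p, x', y']) (p1 := p) (p2 := y') hqS h2 e''.ne
        (((Seg.single G y').cons exy).cons e.symm) ?_ (by simp [hxS, hy', hpS]) e'.symm eyu
        (hon p hpS q hqS e') (hon y' hy' z h2 eyu)).1 e''
      have : p ≠ y' := by rintro rfl; exact hpu eyu
      simp [exy.ne, e.ne', this]

end Adh

namespace Adh

universe u
variable {V : Type u} {G : SimpleGraph V}

/-- `{z, v}` separates `D1` from `D2` -/
structure Spl (G : SimpleGraph V) (z v : V) (D1 D2 : Set V) : Prop where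
  zv : z ≠ v
  all : ∀ w, w = z ∨ w = v ∨ w ∈ D1 ∨ w ∈ D2
  z1 : z ∉ D1
  z2 : z ∉ D2
  v1 : v ∉ D1
  v2 : v ∉ D2
  dis : ∀ w ∈ D1, w ∉ D2
  ne1 : D1.Nonempty
  ne2 : D2.Nonempty
  no : ∀ a ∈ D1, ∀ b ∈ D2, ¬ G.Adj a b

lemma Spl.symm {z v : V} {D1 D2 : Set V} (h : Spl G z v D1 D2) : Spl G z v D2 D1 :=
  ⟨h.zv, fun w => by have := h.all w; tauto, h.z2, h.z1, h.v2, h.v1, fun w h2 h1 => h.dis w h1 h2,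
    h.ne2, h.ne1, fun a ha b hb e => h.no b hb a ha e.symm⟩

lemma Spl.nbr {z v : V} {D1 D2 : Set V} (h : Spl G z v D1 D2) (htc : TC G Set.univ) :
    ∃ d ∈ D1, G.Adj z d := by
  obtain ⟨p, hp⟩ := h.ne1
  obtain ⟨q, hq⟩ := h.ne2
  obtain ⟨c, d, e, _, hd, hc, hd1⟩ := rch_cross (A := D1) (htc.2 v trivial p
    ⟨trivial, by rintro rfl; exact h.v1 hp⟩ q ⟨trivial, by rintro rfl; exact h.v2 hq⟩) hp
    (fun h' => h.dis q h' hq)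
  have hdv : d ≠ v := hd.2
  rcases h.all d with rfl | h' | h' | h'
  · exact ⟨c, hc, e.symm⟩
  · exact absurd h' hdv
  · exact absurd h' hd1
  · exact absurd e (h.no c hc d h')

lemma three_le_ncard [Finite V] {S : Set V} {a b c : V} (ha : a ∈ S) (hb : b ∈ S) (hc : c ∈ S)
    (hab : a ≠ b) (hac : a ≠ c) (hbc : b ≠ c) : 3 ≤ S.ncard := by
  have : ({a, b, c} : Set V).ncard = 3 := Set.ncard_eq_three.2 ⟨a, b, c, hab, hac, hbc, rfl⟩
  rw [← this]
  refine Set.ncard_le_ncard ?_ (Set.toFinite _)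
  rintro x (rfl | rfl | rfl) <;> assumption

lemma Spl.tc [Finite V] {z v : V} {D1 D2 X : Set V} (h : Spl G z v D1 D2) (htc : TC G Set.univ)
    (e : G.Adj z v) (hX : ∀ w ∈ X, G.Adj w z ∧ G.Adj w v) : TC G (D1 ∪ {z, v} ∪ X) := by
  obtain ⟨p, hp⟩ := h.ne1
  have hz : z ∈ D1 ∪ {z, v} ∪ X := by simp
  have hv : v ∈ D1 ∪ {z, v} ∪ X := by simp
  refine ⟨three_le_ncard hz hv (Or.inl (Or.inl hp)) h.zv (by rintro rfl; exact h.z1 hp)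
    (by rintro rfl; exact h.v1 hp), ?_⟩
  intro r _
  have : ∃ k, (k = z ∨ k = v) ∧ k ≠ r := by
    by_cases hr : z = r
    · exact ⟨v, Or.inr rfl, by rintro rfl; exact h.zv hr⟩
    · exact ⟨z, Or.inl rfl, hr⟩
  obtain ⟨k, hk, hkr⟩ := this
  have hkS : k ∈ D1 ∪ {z, v} ∪ X := by rcases hk with rfl | rfl <;> assumption
  have hzv : ∀ b, b = z ∨ b = v → b ≠ r → Rch G ((D1 ∪ {z, v} ∪ X) \ {r}) k b := by
    intro b hb hbr
    have hbS : b ∈ D1 ∪ {z, v} ∪ X := by rcases hb with rfl | rfl <;> assumption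
    by_cases hkb : k = b
    · rw [hkb]; exact Rch.refl _
    · refine Rch.of_adj ?_ ⟨hkS, hkr⟩ ⟨hbS, hbr⟩
      rcases hk with rfl | rfl <;> rcases hb with rfl | rfl
      · exact absurd rfl hkb
      · exact e
      · exact e.symm
      · exact absurd rfl hkb
  have key : ∀ w, Rch G (Set.univ \ {r}) k w → w ∈ D1 → Rch G ((D1 ∪ {z, v} ∪ X) \ {r}) k w := by
    intro w hw
    induction hw with
    | refl => intro _; exact Rch.refl _
    | @tail b c _ hbc ih =>
      intro hc
      have hcS : c ∈ (D1 ∪ {z, v} ∪ X) \ {r} := ⟨Or.inl (Or.inl hc), hbc.2.2.2⟩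
      have hbr : b ≠ r := hbc.2.1.2
      rcases h.all b with hb | hb | hb | hb
      · exact (hzv b (Or.inl hb) hbr).trans (Rch.of_adj hbc.1 ⟨hb ▸ hz, hbr⟩ hcS)
      · exact (hzv b (Or.inr hb) hbr).trans (Rch.of_adj hbc.1 ⟨hb ▸ hv, hbr⟩ hcS)
      · exact (ih hb).trans (Rch.of_adj hbc.1 ⟨Or.inl (Or.inl hb), hbr⟩ hcS)
      · exact absurd hbc.1.symm (h.no c hc b hb)
  refine cn_of_hub k ?_
  rintro w ⟨(hw | hw) | hw, hwr⟩
  · exact (key w (htc.2 r trivial k ⟨trivial, hkr⟩ w ⟨trivial, hwr⟩) hw).symm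
  · exact (hzv w hw hwr).symm
  · refine Rch.of_adj ?_ ⟨Or.inr hw, hwr⟩ ⟨hkS, hkr⟩
    rcases hk with rfl | rfl
    · exact (hX w hw).1
    · exact (hX w hw).2

lemma Spl.ham [Finite V] {z v : V} {D1 D2 : Set V} (h : Spl G z v D1 D2) (htc : TC G Set.univ)
    (hmin : ∀ S, S ≠ Set.univ → TC G S → CycOn G S)
    (e : G.Adj z v) {w2 : V} (hw : w2 ∈ D2) (e1 : G.Adj w2 z) (e2 : G.Adj w2 v)
    (hne : ∃ d ∈ D2, d ≠ w2) : ∃ l, Seg G l z v ∧ l.Nodup ∧ ∀ w, w ∈ l ↔ w ∈ D1 ∨ w = z ∨ w = v := by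
  have ht := h.tc (X := {w2}) htc e (by rintro w rfl; exact ⟨e1, e2⟩)
  have hw1 : w2 ∉ D1 := fun h' => h.dis _ h' hw
  obtain ⟨l, hc, nd, hl⟩ := hmin _ (by
    obtain ⟨d, hd, hdw⟩ := hne
    intro hu
    have : d ∈ (Set.univ : Set V) := trivial
    rw [← hu] at this
    rcases this with (h' | rfl | rfl) | h'
    · exact h.dis d h' hd
    · exact h.z2 hd
    · exact h.v2 hd
    · exact hdw h') ht
  obtain ⟨A, B, rfl⟩ := List.append_of_mem ((hl w2).2 (Or.inr rfl))
  have hc := hc.rot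
  have hm : ∀ w, w ∈ B ++ A ↔ w ∈ D1 ∨ w = z ∨ w = v := by
    intro w
    have := hl w
    simp only [List.nodup_append, List.nodup_cons, List.mem_cons, ne_eq] at nd
    simp only [Set.mem_union, Set.mem_insert_iff, Set.mem_singleton_iff, List.mem_append,
      List.mem_cons] at this ⊢
    have := e1.ne
    have := e2.ne
    grind
  have hnd : (B ++ A).Nodup := by
    have := (List.nodup_append_comm (l₁ := A) (l₂ := w2 :: B)).1 nd
    exact (List.nodup_cons.1 this).2
  rw [List.cons_append] at hc
  obtain ⟨a, d, hs, e'⟩ := hc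
  obtain ⟨rfl, c, hs, e''⟩ := hs.split_cons (List.ne_nil_of_mem ((hm z).2 (by simp)))
  have hcv : c = z ∨ c = v := by
    rcases (hm c).1 hs.left_mem with h' | h'
    · exact absurd e''.symm (h.no c h' w2 hw)
    · exact h'
  have hdv : d = z ∨ d = v := by
    rcases (hm d).1 hs.right_mem with h' | h'
    · exact absurd e' (h.no d h' w2 hw)
    · exact h'
  have hcd : c ≠ d := by
    rintro rfl
    have hz := (hm z).2 (by simp)
    have hv := (hm v).2 (by simp)
    have hl1 : ∀ w ∈ B ++ A, w = c := by
      obtain ⟨L, hL⟩ : ∃ L, L = B ++ A := ⟨_, rfl⟩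
      rw [← hL] at hs hnd ⊢
      match L, hs, hnd with
      | [], hs, _ => exact absurd rfl hs.ne_nil
      | [p], hs, _ => intro w hw; rw [List.mem_singleton.1 hw]; exact hs.single_eq.1
      | p :: q :: L, hs, hnd =>
        obtain ⟨rfl, _, hs', _⟩ := hs.split_cons (by simp)
        exact absurd hs'.right_mem (List.nodup_cons.1 hnd).1
    exact h.zv ((hl1 z hz).trans (hl1 v hv).symm)
  rcases hcv with rfl | rfl <;> rcases hdv with rfl | rfl
  · exact absurd rfl hcd
  · exact ⟨_, hs, hnd, hm⟩
  · exact ⟨_, hs.reverse, List.nodup_reverse.2 hnd, fun w => by rw [List.mem_reverse, hm]⟩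
  · exact absurd rfl hcd

theorem Spl.contra [Finite V] (hcf : ClawFree G) (nh : ¬ HamL G)
    {z v : V} {D1 D2 : Set V} (h : Spl G z v D1 D2) (htc : TC G Set.univ)
    (hmin : ∀ S, S ≠ Set.univ → TC G S → CycOn G S)
    (e : G.Adj z v) {w1 w2 : V} (h1 : w1 ∈ D1) (h2 : w2 ∈ D2) (e1 : G.Adj w1 z) (e2 : G.Adj w1 v)
    (f1 : G.Adj w2 z) (f2 : G.Adj w2 v) : False := by
  have single : ∀ {D1 D2 : Set V} {w1 w2 : V}, Spl G z v D1 D2 → w1 ∈ D1 → w2 ∈ D2 →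
      G.Adj w1 z → G.Adj w1 v → G.Adj w2 z → G.Adj w2 v → ∃ d ∈ D2, d ≠ w2 := by
    intro D1 D2 w1 w2 h h1 h2 e1 e2 f1 f2
    by_contra hne
    push Not at hne
    have ht := h.tc (X := ∅) htc e (by simp)
    have hmem : ∀ w, w ∈ D1 ∪ {z, v} ∪ ∅ ↔ w ≠ w2 := by
      intro w
      constructor
      · rintro ((h' | rfl | rfl) | h') rfl
        · exact h.dis _ h' h2
        · exact h.z2 h2
        · exact h.v2 h2
        · exact h'
      · intro hw
        have := h.all w
        have := hne w
        simp only [Set.mem_union, Set.mem_insert_iff, Set.mem_singleton_iff]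
        tauto
    obtain ⟨l, hc, nd, hl⟩ := hmin _ (fun hu => (hmem w2).1 (by rw [hu]; trivial) rfl) ht
    have hT : TypeI G w2 := ⟨l, hc, nd, fun w => (hl w).trans (hmem w)⟩
    have := typeI_common hcf nh hT f1 f2 h.zv e1.symm e2.symm (by
      rintro rfl; exact h.dis _ h1 h2)
    exact h.no _ h1 _ h2 this.symm
  obtain ⟨l1, s1, nd1, hl1⟩ := h.ham htc hmin e h2 f1 f2 (single h h1 h2 e1 e2 f1 f2)
  obtain ⟨l2, s2, nd2, hl2⟩ := h.symm.ham htc hmin e h1 e1 e2 (single h.symm h2 h1 f1 f2 e1 e2)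
  have hw2 := (hl2 w2).2 (Or.inl h2)
  obtain ⟨M, rfl⟩ : ∃ M, l2 = z :: M := by
    cases l2 with
    | nil => simp at hw2
    | cons a M => exact ⟨M, by have := s2.2.1; simp at this; rw [this]⟩
  have hM : M ≠ [] := by
    rintro rfl
    simp at hw2
    exact h.z2 (hw2 ▸ h2)
  obtain ⟨-, a, s3, g1⟩ := s2.split_cons hM
  obtain ⟨N, rfl⟩ : ∃ N, M = N ++ [v] :=
    ⟨M.dropLast, by
      have hlast : M.getLast hM = v := by
        have := s3.2.2; rw [List.getLast?_eq_some_getLast hM] at this; simpa using this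
      conv_lhs => rw [← List.dropLast_append_getLast hM, hlast]⟩
  have hN : N ≠ [] := by
    rintro rfl
    simp at hw2
    rcases hw2 with h' | h'
    · exact h.z2 (h' ▸ h2)
    · exact h.v2 (h' ▸ h2)
  obtain ⟨b, c, s4, s5, g2⟩ := s3.split hN (by simp)
  obtain ⟨rfl, -⟩ := s5.single_eq
  have hNm : ∀ w, w ∈ N ↔ w ∈ D2 := by
    intro w
    have := hl2 w
    have := h.z2
    have := h.v2
    simp only [List.nodup_append, List.nodup_cons, List.mem_cons, List.mem_append, ne_eq] at *
    grind
  refine nh ⟨l1 ++ N.reverse, ⟨z, a, s1.append s4.reverse g2.symm, g1.symm⟩, ?_, ?_⟩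
  · rw [List.nodup_append]
    refine ⟨nd1, ?_, ?_⟩
    · have := (List.nodup_cons.1 nd2).2
      exact List.nodup_reverse.2 (List.nodup_append.1 this).1
    · rintro p hp q hq rfl
      rw [List.mem_reverse, hNm] at hq
      rcases (hl1 p).1 hp with h' | rfl | rfl
      · exact h.dis _ h' hq
      · exact h.z2 hq
      · exact h.v2 hq
  · intro w
    rw [List.mem_append, List.mem_reverse, hNm, hl1]
    have := h.all w
    tauto

/-- no induced diamonds -/
theorem diamond_free [Finite V] (hcf : ClawFree G) (htc : TC G Set.univ)
    (nh : ¬ HamL G) (hmin : ∀ S, S ≠ Set.univ → TC G S → CycOn G S) {z b a c : V}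
    (zb : G.Adj z b) (za : G.Adj z a) (zc : G.Adj z c) (ba : G.Adj b a) (bc : G.Adj b c)
    (hac : a ≠ c) : G.Adj a c := by
  by_cases hz : TypeI G z
  · exact typeI_closed hcf nh hz za zc hac ba.symm bc.symm zb
  by_contra hn
  have hnt : ¬ TC G (Set.univ \ {z}) := by
    intro ht
    obtain ⟨l, hc, nd, hl⟩ := hmin _ (fun hu => by
      have : z ∈ (Set.univ : Set V) := trivial
      rw [← hu] at this; exact this.2 rfl) ht
    exact hz ⟨l, hc, nd, fun v => by rw [hl]; simp⟩
  have hcard : 3 ≤ (Set.univ \ {z} : Set V).ncard :=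
    three_le_ncard ⟨trivial, za.ne'⟩ ⟨trivial, zb.ne'⟩ ⟨trivial, zc.ne'⟩ ba.ne' hac bc.ne
  have : ∃ v ∈ (Set.univ \ {z} : Set V), ¬ Cn G ((Set.univ \ {z}) \ {v}) := by
    by_contra hcon
    push Not at hcon
    exact hnt ⟨hcard, hcon⟩
  obtain ⟨v, ⟨-, hvz⟩, hv⟩ := this
  have hvz : v ≠ z := hvz
  unfold Cn at hv
  push Not at hv
  obtain ⟨p, hp, q, hq, hpq⟩ := hv
  have hS : Spl G z v {w | w ≠ z ∧ w ≠ v ∧ Rch G ((Set.univ \ {z}) \ {v}) p w}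
      {w | w ≠ z ∧ w ≠ v ∧ ¬ Rch G ((Set.univ \ {z}) \ {v}) p w} := by
    refine ⟨hvz.symm, fun w => ?_, fun h => h.1 rfl, fun h => h.1 rfl, fun h => h.2.1 rfl,
      fun h => h.2.1 rfl, fun w h h' => h'.2.2 h.2.2, ⟨p, hp.1.2, hp.2, Rch.refl _⟩,
      ⟨q, hq.1.2, hq.2, hpq⟩, ?_⟩
    · simp only [Set.mem_ofPred_eq]; tauto
    · intro a ha b hb e
      exact hb.2.2 (ha.2.2.trans (Rch.of_adj e ⟨⟨trivial, ha.1⟩, ha.2.1⟩ ⟨⟨trivial, hb.1⟩, hb.2.1⟩))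
  generalize {w | w ≠ z ∧ w ≠ v ∧ Rch G ((Set.univ \ {z}) \ {v}) p w} = D1 at hS
  generalize {w | w ≠ z ∧ w ≠ v ∧ ¬ Rch G ((Set.univ \ {z}) \ {v}) p w} = D2 at hS
  -- two nonadjacent neighbours of `z` are not both on one side
  have side : ∀ {D1 D2 : Set V}, Spl G z v D1 D2 → a ∈ D1 → c ∈ D1 → False := by
    intro D1 D2 h ha hc
    obtain ⟨d, hd, e⟩ := h.symm.nbr htc
    exact hcf z a c d ⟨za, zc, e, hn, h.no _ ha _ hd, h.no _ hc _ hd, hac,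
      by rintro rfl; exact h.dis _ ha hd, by rintro rfl; exact h.dis _ hc hd⟩
  have hbD : ∀ {D1 D2 : Set V}, Spl G z v D1 D2 → b ∈ D1 → False := by
    intro D1 D2 h hb
    obtain ⟨d, hd, e⟩ := h.symm.nbr htc
    have fin : ∀ {a c : V}, a = v → G.Adj z a → G.Adj z c → G.Adj b a → G.Adj b c →
        a ≠ c → ¬ G.Adj a c → False := by
      intro a c hav za zc ba bc hac hn
      subst hav
      have hc : c ∈ D1 := by
        rcases h.all c with h' | h' | h' | h'
        · exact absurd h' zc.ne'
        · exact absurd h'.symm hac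
        · exact h'
        · exact absurd bc (h.no _ hb _ h')
      have hda := claw3 hcf zc za e (fun e => hn e.symm) (h.no _ hc _ hd) hac.symm
        (by rintro rfl; exact h.dis _ hc hd) (by rintro rfl; exact h.v2 hd)
      exact h.contra hcf nh htc hmin za hb hd zb.symm ba e.symm hda.symm
    rcases h.all a with h' | h' | h' | h'
    · exact za.ne' h'
    · exact fin h' za zc ba bc hac hn
    · rcases h.all c with h'' | h'' | h'' | h''
      · exact zc.ne' h''
      · exact fin h'' zc za bc ba hac.symm (fun e => hn e.symm)
      · exact side h h' h''
      · exact h.no _ hb _ h'' bc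
    · exact h.no _ hb _ h' ba
  rcases hS.all b with h | h | h | h
  · exact zb.ne' h
  · subst h
    rcases hS.all a with h' | h' | h' | h'
    · exact za.ne' h'
    · exact ba.ne' h'
    · rcases hS.all c with h'' | h'' | h'' | h''
      · exact zc.ne' h''
      · exact bc.ne' h''
      · exact side hS h' h''
      · exact hS.contra hcf nh htc hmin zb h' h'' za.symm ba.symm zc.symm bc.symm
    · rcases hS.all c with h'' | h'' | h'' | h''
      · exact zc.ne' h''
      · exact bc.ne' h''
      · exact hS.contra hcf nh htc hmin zb h'' h' zc.symm bc.symm za.symm ba.symm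
      · exact side hS.symm h' h''
  · exact hbD hS h
  · exact hbD hS.symm h

end Adh

namespace Adh

universe u
variable {V : Type u} {G : SimpleGraph V}

/-- induced path on five vertices whose ends have a common neighbour -/
lemma ind5 (hadh : ADH G) {v0 v1 v2 v3 v4 w : V} (a01 : G.Adj v0 v1) (a12 : G.Adj v1 v2)
    (a23 : G.Adj v2 v3) (a34 : G.Adj v3 v4) (n02 : ¬ G.Adj v0 v2) (n03 : ¬ G.Adj v0 v3)
    (n04 : ¬ G.Adj v0 v4) (n13 : ¬ G.Adj v1 v3) (n14 : ¬ G.Adj v1 v4) (n24 : ¬ G.Adj v2 v4)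
    (w0 : G.Adj v0 w) (w4 : G.Adj w v4) : False := by
  have hs : Seg G [v0, v1, v2, v3, v4] v0 v4 :=
    ((((Seg.single G v4).cons a34).cons a23).cons a12).cons a01
  have d04 : v0 ≠ v4 := by rintro rfl; exact n03 a34.symm
  have d14 : v1 ≠ v4 := by rintro rfl; exact n04 a01
  have d24 : v2 ≠ v4 := by rintro rfl; exact n14 a12
  have d34 : v3 ≠ v4 := a34.ne
  obtain ⟨j, hj, hw⟩ := hadh {v | v ∈ [v0, v1, v2, v3, v4]} (seg_cn hs (fun _ => Iff.rfl)) v0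
    (by simp) v4 (by simp) 2 ⟨w, trivial, w0, v4, trivial, w4, rfl⟩
  match j, hj, hw with
  | 0, _, hw => exact d04 hw
  | 1, _, ⟨z, _, e, hz⟩ =>
    have hz : z = v4 := hz
    exact n04 (hz ▸ e)
  | 2, _, ⟨q, hq, e, z, _, e', hz⟩ =>
    have hz : z = v4 := hz
    subst hz
    simp only [List.mem_cons, List.not_mem_nil, or_false, Set.mem_ofPred_eq] at hq
    rcases hq with rfl | rfl | rfl | rfl | rfl
    · exact n04 e'
    · exact n14 e'
    · exact n24 e'
    · exact n03 e
    · exact n04 e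
  | 3, _, ⟨p, hp, e, q, hq, e', z, _, e'', hz⟩ =>
    have hz : z = v4 := hz
    subst hz
    simp only [List.mem_cons, List.not_mem_nil, or_false, Set.mem_ofPred_eq] at hq hp
    have hq : q = v3 := by
      rcases hq with rfl | rfl | rfl | rfl | rfl
      · exact absurd e'' n04
      · exact absurd e'' n14
      · exact absurd e'' n24
      · rfl
      · exact absurd rfl e''.ne
    subst hq
    rcases hp with rfl | rfl | rfl | rfl | rfl
    · exact e.ne rfl
    · exact n13 e'
    · exact n02 e
    · exact n03 e
    · exact n04 e

/-- induced path on six vertices whose ends have a common neighbour -/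
lemma ind6 (hadh : ADH G) {v0 v1 v2 v3 v4 v5 w : V} (a01 : G.Adj v0 v1) (a12 : G.Adj v1 v2)
    (a23 : G.Adj v2 v3) (a34 : G.Adj v3 v4) (a45 : G.Adj v4 v5)
    (n02 : ¬ G.Adj v0 v2) (n03 : ¬ G.Adj v0 v3)
    (n04 : ¬ G.Adj v0 v4) (n05 : ¬ G.Adj v0 v5) (n13 : ¬ G.Adj v1 v3) (n14 : ¬ G.Adj v1 v4)
    (n15 : ¬ G.Adj v1 v5) (n25 : ¬ G.Adj v2 v5) (n35 : ¬ G.Adj v3 v5)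
    (w0 : G.Adj v0 w) (w5 : G.Adj w v5) : False := by
  have hs : Seg G [v0, v1, v2, v3, v4, v5] v0 v5 :=
    (((((Seg.single G v5).cons a45).cons a34).cons a23).cons a12).cons a01
  have d05 : v0 ≠ v5 := by rintro rfl; exact n04 a45.symm
  obtain ⟨j, hj, hw⟩ := hadh {v | v ∈ [v0, v1, v2, v3, v4, v5]} (seg_cn hs (fun _ => Iff.rfl)) v0
    (by simp) v5 (by simp) 2 ⟨w, trivial, w0, v5, trivial, w5, rfl⟩
  have last : ∀ q, q ∈ ({v | v ∈ [v0, v1, v2, v3, v4, v5]} : Set V) → G.Adj q v5 → q = v4 := by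
    intro q hq e''
    simp only [List.mem_cons, List.not_mem_nil, or_false, Set.mem_ofPred_eq] at hq
    rcases hq with rfl | rfl | rfl | rfl | rfl | rfl
    · exact absurd e'' n05
    · exact absurd e'' n15
    · exact absurd e'' n25
    · exact absurd e'' n35
    · rfl
    · exact absurd rfl e''.ne
  match j, hj, hw with
  | 0, _, hw => exact d05 hw
  | 1, _, ⟨z, _, e, hz⟩ =>
    have hz : z = v5 := hz
    exact n05 (hz ▸ e)
  | 2, _, ⟨q, hq, e, z, _, e', hz⟩ =>
    have hz : z = v5 := hz
    subst hz
    have := last q hq e'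
    subst this
    exact n04 e
  | 3, _, ⟨p, hp, e, q, hq, e', z, _, e'', hz⟩ =>
    have hz : z = v5 := hz
    subst hz
    have := last q hq e''
    subst this
    simp only [List.mem_cons, List.not_mem_nil, or_false, Set.mem_ofPred_eq] at hp
    rcases hp with rfl | rfl | rfl | rfl | rfl | rfl
    · exact e.ne rfl
    · exact n14 e'
    · exact n02 e
    · exact n03 e
    · exact n04 e
    · exact n05 e

/-- standing assumptions of the last part of the proof -/
structure Ctx (G : SimpleGraph V) (x : V) : Prop where
  hcf : ClawFree G
  hadh : ADH G
  htc : TC G Set.univ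
  nh : ¬ HamL G
  hx : TypeI G x
  df : ∀ {z b a c : V}, G.Adj z b → G.Adj z a → G.Adj z c → G.Adj b a → G.Adj b c → a ≠ c → G.Adj a c

/-- neighbours of `u` at distance two from `x` -/
def M (G : SimpleGraph V) (x u z : V) : Prop := G.Adj u z ∧ z ≠ x ∧ ¬ G.Adj x z

namespace Ctx

variable {x : V}

lemma uniq (C : Ctx G x) {u c z : V} (hu : G.Adj x u) (hz : M G x u z) (hc : G.Adj x c) (e : G.Adj c z) :
    c = u := by
  by_contra h
  exact hz.2.2 (typeI_common C.hcf C.nh C.hx hu hc (Ne.symm h) hz.1 e hz.2.1)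

lemma clique (C : Ctx G x) {u z w : V} (hu : G.Adj x u) (hz : M G x u z) (hw : M G x u w) (h : z ≠ w) :
    G.Adj z w :=
  claw3 C.hcf hu.symm hz.1 hw.1 hz.2.2 hw.2.2 hz.2.1.symm hw.2.1.symm h

lemma out (C : Ctx G x) {u c z : V} (hu : G.Adj x u) (hz : M G x u z) (e : G.Adj c z) (hc : c ≠ u) :
    c ≠ x ∧ ¬ G.Adj x c :=
  ⟨by rintro rfl; exact hz.2.2 e, fun h => hc (C.uniq hu hz h e)⟩

lemma closed (C : Ctx G x) {u c z w : V} (hu : G.Adj x u) (hz : M G x u z) (hw : M G x u w) (h : z ≠ w)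
    (e1 : G.Adj c z) (e2 : G.Adj c w) (hc : c ≠ u) : M G x u c :=
  ⟨C.df (C.clique hu hz hw h) hz.1.symm e1.symm hw.1.symm e2.symm hc.symm, C.out hu hz e1 hc⟩

lemma second (C : Ctx G x) {u c d z : V} (hz : M G x u z) (e1 : G.Adj c z) (e2 : G.Adj d z)
    (nc : ¬ G.Adj u c) (nd : ¬ G.Adj u d) (hc : c ≠ u) (hd : d ≠ u) (h : c ≠ d) : G.Adj c d :=
  claw3 C.hcf hz.1.symm e1.symm e2.symm nc nd hc.symm hd.symm h

lemma extra (C : Ctx G x) [Finite V] {u : V} (hu : G.Adj x u) (z : V) : ∃ f, M G x u f ∧ f ≠ z := by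
  have : ∃ w, G.Adj x w ∧ w ≠ u := by
    obtain ⟨u1, u2, e1, e2, h⟩ := exists_two_nbrs C.htc x
    by_cases h1 : u1 = u
    · exact ⟨u2, e2, by rintro rfl; exact h h1⟩
    · exact ⟨u1, e1, h1⟩
  obtain ⟨w, hw, hwu⟩ := this
  obtain ⟨p⟩ := typeI_pair C.hcf C.nh C.hx hu hw hwu.symm
  have nx : ∀ v, v ∈ p.Q1 ∨ v ∈ p.Q2 → v ≠ x := by
    intro v hv
    have nd := p.nd
    simp only [List.nodup_append, List.nodup_cons, List.cons_append, List.mem_append,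
        List.mem_cons, ne_eq] at nd
    grind
  by_cases h : p.a1 = z
  · exact ⟨p.b1, ⟨p.e4.symm, nx _ (.inr p.hQ2.right_mem), p.n2⟩, by rw [← h]; exact p.A1.ne'⟩
  · exact ⟨p.a1, ⟨p.e1, nx _ (.inl p.hQ1.left_mem), p.n1⟩, h⟩

/-- vertices of different `M`s -/
lemma nadj (C : Ctx G x) {u v z : V} (hu : G.Adj x u) (hv : G.Adj x v) (huv : u ≠ v) (hz : M G x u z) :
    ¬ G.Adj v z := fun e => huv (C.uniq hu hz hv e).symm

lemma b2 (C : Ctx G x) [Finite V] {u1 u2 s1 s2 t : V} (h1 : G.Adj x u1) (h2 : G.Adj x u2) (e12 : G.Adj u1 u2)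
    (m1 : M G x u1 s1) (m2 : M G x u2 s2) (t1 : ¬ G.Adj u1 t) (t2 : ¬ G.Adj u2 t)
    (e1 : G.Adj t s1) (e2 : G.Adj t s2) : False := by
  obtain ⟨f, hf, hfs⟩ := C.extra h1 s1
  have k1 : ¬ G.Adj u2 s1 := C.nadj h1 h2 e12.ne m1
  have k2 : ¬ G.Adj u1 s2 := C.nadj h2 h1 e12.ne' m2
  have k3 : ¬ G.Adj u2 f := C.nadj h1 h2 e12.ne hf
  have tu1 : t ≠ u1 := by rintro rfl; exact k2 e2
  have tu2 : t ≠ u2 := by rintro rfl; exact k1 e1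
  have ft : ¬ G.Adj t f := fun h => t1 (C.closed h1 m1 hf hfs.symm e1 h tu1).1
  have fs2 : ¬ G.Adj f s2 := by
    intro h
    exact ft (C.second m2 e2 h t2 k3 tu2 (by rintro rfl; exact hf.2.2 h2) (by
      rintro rfl; exact t1 hf.1))
  exact ind5 C.hadh (v0 := f) (v1 := u1) (v2 := u2) (v3 := s2) (v4 := t) (w := s1) hf.1.symm e12
    m2.1 e2.symm (fun h => k3 h.symm) fs2 (fun h => ft h.symm) k2 t1 t2
    (C.clique h1 hf m1 hfs) e1.symm

lemma tri (C : Ctx G x) [Finite V] {u1 u2 z1 z2 c : V} (h1 : G.Adj x u1) (h2 : G.Adj x u2) (h12 : u1 ≠ u2)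
    (m1 : M G x u1 z1) (m2 : M G x u2 z2) (e : G.Adj z1 z2) (e1 : G.Adj c z1) (e2 : G.Adj c z2) :
    False := by
  have k1 : ¬ G.Adj u2 z1 := C.nadj h1 h2 h12 m1
  have k2 : ¬ G.Adj u1 z2 := C.nadj h2 h1 h12.symm m2
  have cu1 : c ≠ u1 := by rintro rfl; exact k2 e2
  have cu2 : c ≠ u2 := by rintro rfl; exact k1 e1
  have zu1 : z1 ≠ u2 := by rintro rfl; exact m1.2.2 h2
  have zu2 : z2 ≠ u1 := by rintro rfl; exact m2.2.2 h1
  obtain ⟨cx, cn⟩ := C.out h1 m1 e1 cu1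
  have c1 : ¬ G.Adj u1 c := fun h =>
    k2 (C.closed h1 m1 ⟨h, cx, cn⟩ e1.ne' e.symm e2.symm zu2).1
  have c2 : ¬ G.Adj u2 c := fun h =>
    k1 (C.closed h2 m2 ⟨h, cx, cn⟩ e2.ne' e e1.symm zu1).1
  by_cases e12 : G.Adj u1 u2
  · exact C.b2 h1 h2 e12 m1 m2 c1 c2 e1 e2
  obtain ⟨f, hf, hfs⟩ := C.extra h1 z1
  have k3 : ¬ G.Adj u2 f := C.nadj h1 h2 h12 hf
  have cf : ¬ G.Adj c f := fun h => c1 (C.closed h1 m1 hf hfs.symm e1 h cu1).1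
  have zf : ¬ G.Adj z2 f := fun h => k2 (C.closed h1 m1 hf hfs.symm e.symm h zu2).1
  exact ind6 C.hadh (v0 := c) (v1 := z2) (v2 := u2) (v3 := x) (v4 := u1) (v5 := f) (w := z1)
    e2 m2.1.symm h2.symm h1 hf.1 (fun h => c2 h.symm) (fun h => cn h.symm) (fun h => c1 h.symm) cf
    (fun h => m2.2.2 h.symm) (fun h => k2 h.symm) zf k3 hf.2.2 e1 (C.clique h1 m1 hf hfs.symm)

end Ctx

end Adh

namespace Adh

universe u
variable {V : Type u} {G : SimpleGraph V}

lemma skip {s : Set V} : ∀ (n : ℕ) (L : List V) (a : V), L.length ≤ n → (a :: L).IsChain G.Adj →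
    a ∈ s → (∀ A p v q B, a :: L = A ++ p :: v :: q :: B → v ∉ s → G.Adj p q ∧ q ∈ s) →
    ∀ w ∈ L, w ∈ s → Rch G s a w := by
  intro n
  induction n with
  | zero =>
    intro L a hL _ _ _ w hw
    have : L = [] := List.length_eq_zero_iff.1 (by omega)
    simp [this] at hw
  | succ n ih =>
    intro L a hL hc ha hsp w hw hws
    match L, hL, hc, hsp, hw with
    | v :: L', hL, hc, hsp, hw =>
      rw [List.isChain_cons_cons] at hc
      by_cases hv : v ∈ s
      · have hav := Rch.of_adj hc.1 ha hv
        rcases List.mem_cons.1 hw with rfl | hw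
        · exact hav
        · refine hav.trans (ih L' v (by simpa using hL) hc.2 hv ?_ w hw hws)
          intro A p v' q B h
          exact hsp (a :: A) p v' q B (by rw [h]; rfl)
      · rcases List.mem_cons.1 hw with rfl | hw
        · exact absurd hws hv
        match L', hL, hc, hsp, hw with
        | q :: L'', hL, hc, hsp, hw =>
          obtain ⟨e, hq⟩ := hsp [] a v q L'' rfl hv
          have haq := Rch.of_adj e ha hq
          rcases List.mem_cons.1 hw with rfl | hw
          · exact haq
          · rw [List.isChain_cons_cons] at hc
            refine haq.trans (ih L'' q ?_ hc.2.2 hq ?_ w hw hws)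
            · simp at hL; omega
            · intro A p v' q B h
              exact hsp (a :: v :: A) p v' q B (by rw [h]; rfl)

namespace Ctx

variable {x : V}

lemma conn (C : Ctx G x) {u1 : V} (h1 : G.Adj x u1) : Cn G {w | w = u1 ∨ (w ≠ x ∧ ¬ G.Adj x w)} := by
  obtain ⟨l, hc, nd, hl⟩ := C.hx
  obtain ⟨A, B, rfl⟩ := List.append_of_mem ((hl u1).2 h1.ne')
  have hp0 : (A ++ u1 :: B).Perm (u1 :: (B ++ A)) := by
    classical
    rw [List.perm_iff_count]; intro v; simp [List.count_append, List.count_cons]; omega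
  have hc := hc.rot
  rw [List.cons_append] at hc
  have nd := hp0.nodup_iff.1 nd
  have hl : ∀ v, v ∈ u1 :: (B ++ A) ↔ v ≠ x := fun v => by rw [← hl v, hp0.mem_iff]
  generalize B ++ A = L at hc nd hl
  clear hp0
  have hch : (u1 :: L).IsChain G.Adj := by obtain ⟨a, b, hs, _⟩ := hc; exact hs.1
  refine cn_of_hub u1 ?_
  intro w hw
  by_cases hwu : w = u1
  · rw [hwu]; exact Rch.refl _
  have hwx : w ≠ x := by
    rcases hw with rfl | hw
    · exact h1.ne'
    · exact hw.1
  have hwL : w ∈ L := (List.mem_cons.1 ((hl w).2 hwx)).resolve_left hwu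
  refine (skip L.length L u1 le_rfl hch (Or.inl rfl) ?_ w hwL hw).symm
  intro A p v q B h hv
  simp only [Set.mem_ofPred_eq, not_or, not_and, not_not] at hv
  have hvL : v ∈ u1 :: L := by rw [h]; simp
  have hxv := hv.2 ((hl v).1 hvL)
  -- the pair decomposition at `v`
  obtain ⟨Q1, hQ⟩ : ∃ Q1, u1 :: L = u1 :: (Q1 ++ v :: (q :: B)) ∧ A ++ [p] = u1 :: Q1 := by
    cases A with
    | nil =>
      simp only [List.nil_append, List.cons.injEq] at h
      exact ⟨[], by rw [h.2]; rfl, by simp [h.1]⟩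
    | cons a A =>
      simp only [List.cons_append, List.cons.injEq] at h
      exact ⟨A ++ [p], by rw [h.2]; simp, by simp [h.1]⟩
  obtain ⟨hQ, hA⟩ := hQ
  rw [hQ] at hc nd hl
  obtain ⟨P, hP1, hP2⟩ := pair_of_list C.hcf C.nh hc nd hl h1 hxv
  have ha2 : P.a2 = q := by
    have := P.hQ2.2.1; rw [hP2] at this; simpa using this.symm
  have hb2 : P.b2 = p := by
    have h3 := P.hQ1.2.2
    have h4 := P.hQ1.ne_nil
    rw [hP1] at h3 h4
    have : (A ++ [p]).getLast? = some P.b2 := by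
      rw [hA, List.getLast?_cons, h3]; rfl
    simpa using this.symm
  refine ⟨by rw [← ha2, ← hb2]; exact P.A2.symm, Or.inr ⟨?_, by rw [← ha2]; exact P.n3⟩⟩
  rw [← hl]; simp

/-- adjacent pair between `M u1` and `M u2` -/
lemma ap (C : Ctx G x) [Finite V] {u1 u2 : V} (h1 : G.Adj x u1) (h2 : G.Adj x u2) (h12 : u1 ≠ u2) :
    ∃ z1 z2, M G x u1 z1 ∧ M G x u2 z2 ∧ G.Adj z1 z2 := by
  by_cases e12 : G.Adj u1 u2
  · obtain ⟨z, hz, -⟩ := C.extra h2 x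
    have k2 : ¬ G.Adj u1 z := C.nadj h2 h1 h12.symm hz
    obtain ⟨j, hj, hw⟩ := C.hadh _ (C.conn h1) u1 (Or.inl rfl) z (Or.inr hz.2) 2
      ⟨u2, trivial, e12, z, trivial, hz.1, rfl⟩
    match j, hj, hw with
    | 0, _, hw =>
      have hw : u1 = z := hw
      exact absurd (hw ▸ h1) hz.2.2
    | 1, _, ⟨z', _, e, hz'⟩ =>
      have hz' : z' = z := hz'
      exact absurd (hz' ▸ e) k2
    | 2, _, ⟨p, hp, e, z', _, e', hz'⟩ =>
      have hz' : z' = z := hz'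
      subst hz'
      rcases hp with rfl | hp
      · exact absurd rfl e.ne
      · exact ⟨p, z', ⟨e, hp⟩, hz, e'⟩
    | 3, _, ⟨p, hp, e, q, hq, e', z', _, e'', hz'⟩ =>
      have hz' : z' = z := hz'
      subst hz'
      rcases hp with rfl | hp
      · exact absurd rfl e.ne
      rcases hq with rfl | hq
      · exact absurd e'' k2
      by_cases q1 : G.Adj u1 q
      · exact ⟨q, z', ⟨q1, hq⟩, hz, e''⟩
      by_cases q2 : G.Adj u2 q
      · exact ⟨p, q, ⟨e, hp⟩, ⟨q2, hq⟩, e'⟩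
      exact (C.b2 h1 h2 e12 ⟨e, hp⟩ hz q1 q2 e'.symm e'').elim
  · have cl : ∀ w, G.Adj u1 w → G.Adj u2 w → w ≠ x → False := by
      intro w w1 w2 wx
      have := typeI_common C.hcf C.nh C.hx h1 h2 h12 w1 w2 wx
      exact e12 (typeI_closed C.hcf C.nh C.hx h1 h2 h12 w1 w2 this)
    obtain ⟨j, hj, hw⟩ := C.hadh _ (C.htc.2 x trivial) u1 ⟨trivial, h1.ne'⟩ u2 ⟨trivial, h2.ne'⟩ 2
      ⟨x, trivial, h1.symm, u2, trivial, h2, rfl⟩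
    match j, hj, hw with
    | 0, _, hw => exact absurd hw h12
    | 1, _, ⟨z', _, e, hz'⟩ =>
      have hz' : z' = u2 := hz'
      exact absurd (hz' ▸ e) e12
    | 2, _, ⟨p, hp, e, z', _, e', hz'⟩ =>
      have hz' : z' = u2 := hz'
      subst hz'
      exact (cl p e e'.symm hp.2).elim
    | 3, _, ⟨p, hp, e, q, hq, e', z', _, e'', hz'⟩ =>
      have hz' : z' = u2 := hz'
      subst hz'
      have px : p ≠ x := hp.2
      have qx : q ≠ x := hq.2
      have pu : p ≠ z' := by rintro rfl; exact e12 e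
      have qu : u1 ≠ q := by rintro rfl; exact e12 e''
      have hxp : ¬ G.Adj x p := by
        intro h
        have hq := typeI_common C.hcf C.nh C.hx h h2 pu e' e''.symm qx
        have := typeI_closed C.hcf C.nh C.hx h1 hq qu e e'.symm h
        exact cl q this e''.symm qx
      have hxq : ¬ G.Adj x q := fun h =>
        hxp (typeI_common C.hcf C.nh C.hx h1 h qu e e'.symm px)
      exact ⟨p, q, ⟨e, px, hxp⟩, ⟨e''.symm, qx, hxq⟩, e'⟩

lemma three (C : Ctx G x) [Finite V] {u v w : V} (hu : G.Adj x u) (hv : G.Adj x v) (hw : G.Adj x w)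
    (e : G.Adj u v) (uw : u ≠ w) (vw : v ≠ w) : False := by
  obtain ⟨zu, zw, m1, m2, e1⟩ := C.ap hu hw uw
  obtain ⟨yv, yw, m3, m4, e2⟩ := C.ap hv hw vw
  have a1 : ¬ G.Adj u yv := C.nadj hv hu e.ne' m3
  have a2 : ¬ G.Adj v zu := C.nadj hu hv e.ne m1
  have a3 : ¬ G.Adj v zw := C.nadj hw hv vw.symm m2
  have a4 : ¬ G.Adj v yw := C.nadj hw hv vw.symm m4
  have a5 : ¬ G.Adj w zu := C.nadj hu hw uw m1
  have a6 : ¬ G.Adj w yv := C.nadj hv hw vw m3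
  have a7 : ¬ G.Adj u zw := C.nadj hw hu uw.symm m2
  have d1 : zu ≠ yv := by rintro rfl; exact a1 m1.1
  have d2 : zu ≠ w := by rintro rfl; exact m1.2.2 hw
  have d3 : yv ≠ w := by rintro rfl; exact m3.2.2 hw
  have d4 : yv ≠ u := by rintro rfl; exact m3.2.2 hu
  have d5 : zw ≠ u := by rintro rfl; exact m2.2.2 hu
  have d6 : yv ≠ zw := by rintro rfl; exact a3 m3.1
  by_cases hz : zw = yw
  · subst hz
    have := C.second m2 e1 e2 a5 a6 d2 d3 d1
    exact C.tri hu hw uw m1 m2 e1 this.symm e2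
  · have n1 : ¬ G.Adj zu yw := fun h => a5 (C.closed hw m2 m4 hz e1 h d2).1
    have n2 : ¬ G.Adj yv zw := fun h => a6 (C.closed hw m2 m4 hz h e2 d3).1
    have n3 : ¬ G.Adj zu yv := by
      intro h
      have := C.second m1 h.symm e1.symm a1 a7 d4 d5 d6
      exact n2 this
    exact ind5 C.hadh (v0 := zu) (v1 := zw) (v2 := yw) (v3 := yv) (v4 := v) (w := u) e1
      (C.clique hw m2 m4 hz) e2.symm m3.1.symm n1 n3 (fun h => a2 h.symm) (fun h => n2 h.symm)
      (fun h => a3 h.symm) (fun h => a4 h.symm) m1.1.symm e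

lemma two (C : Ctx G x) [Finite V] {u v w : V} (hu : G.Adj x u) (hv : G.Adj x v) (huv : u ≠ v)
    (hw : G.Adj x w) : w = u ∨ w = v := by
  by_contra h
  push Not at h
  by_cases e1 : G.Adj u v
  · exact C.three hu hv hw e1 h.1.symm h.2.symm
  by_cases e2 : G.Adj u w
  · exact C.three hu hw hv e2 huv h.2
  have := claw3 C.hcf hu hv hw e1 e2 huv h.1.symm h.2.symm
  exact C.three hv hw hu this huv.symm h.1

end Ctx

end Adh

namespace Adh

universe u
variable {V : Type u} {G : SimpleGraph V}

lemma list_mid {P1 P2 : V → Prop} : ∀ (L : List V), (∃ y ∈ L, P2 y) → ∀ (z : V) (I0 : List V), P1 z →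
    (∀ i ∈ I0, ¬ P1 i ∧ ¬ P2 i) → ∃ A z1 I z2 B, z :: (I0 ++ L) = A ++ z1 :: (I ++ z2 :: B) ∧
    P1 z1 ∧ P2 z2 ∧ ∀ i ∈ I, ¬ P1 i ∧ ¬ P2 i := by
  intro L
  induction L with
  | nil => rintro ⟨y, hy, _⟩; simp at hy
  | cons c L ih =>
    rintro ⟨y, hy, hy2⟩ z I0 hz hI
    by_cases c2 : P2 c
    · exact ⟨[], z, I0, c, L, rfl, hz, c2, hI⟩
    have hyL : ∃ y ∈ L, P2 y := by
      rcases List.mem_cons.1 hy with rfl | hy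
      · exact absurd hy2 c2
      · exact ⟨y, hy, hy2⟩
    by_cases c1 : P1 c
    · obtain ⟨A, z1, I, z2, B, h, h'⟩ := ih hyL c [] c1 (by simp)
      refine ⟨z :: (I0 ++ A), z1, I, z2, B, ?_, h'⟩
      rw [List.nil_append] at h
      rw [h]; simp
    · obtain ⟨A, z1, I, z2, B, h, h'⟩ := ih hyL z (I0 ++ [c]) hz (by
        intro i hi
        rcases List.mem_append.1 hi with hi | hi
        · exact hI i hi
        · rw [List.mem_singleton.1 hi]; exact ⟨c1, c2⟩)
      refine ⟨A, z1, I, z2, B, ?_, h'⟩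
      rw [← h]; simp

theorem Ctx.final [Finite V] {x : V} (C : Ctx G x) : False := by
  obtain ⟨u1, u2, h1, h2, h12⟩ := exists_two_nbrs C.htc x
  obtain ⟨p⟩ := typeI_pair C.hcf C.nh C.hx h1 h2 h12
  obtain ⟨Q1, Q2, a1, b1, a2, b2, hQ1, hQ2, e1, e2, e3, e4, nd, all, HN, -, -, -, -, A1, A2,
    -, -, -, -⟩ := p
  have hW : ∀ v ∈ Q1, v ≠ u1 ∧ v ≠ u2 ∧ v ≠ x ∧ ¬ G.Adj x v := by
    intro v hv
    have : v ≠ u1 ∧ v ≠ u2 ∧ v ≠ x := by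
      simp only [List.nodup_append, List.nodup_cons, List.cons_append, List.mem_append,
          List.mem_cons, ne_eq] at nd
      grind
    refine ⟨this.1, this.2.1, this.2.2, fun h => ?_⟩
    rcases C.two h1 h2 h12 h with h | h
    · exact this.1 h
    · exact this.2.1 h
  have hmid : ∃ A z1 I z2 B, Q1 = A ++ z1 :: (I ++ z2 :: B) ∧ G.Adj u1 z1 ∧ G.Adj u2 z2 ∧
      ∀ i ∈ I, ¬ G.Adj u1 i ∧ ¬ G.Adj u2 i := by
    have ha := hQ1.2.1
    have hb := hQ1.right_mem
    match Q1, ha, hb with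
    | a :: L, ha, hb =>
      have ha : a = a1 := by simpa using ha
      subst ha
      have : b2 ∈ L := by
        rcases List.mem_cons.1 hb with rfl | h
        · exact absurd e1 (C.nadj h2 h1 h12.symm ⟨e2.symm, (hW b2 hb).2.2⟩)
        · exact h
      simpa using list_mid (P1 := fun v => G.Adj u1 v) (P2 := fun v => G.Adj u2 v) L
        ⟨b2, this, e2.symm⟩ a [] e1 (by simp)
  obtain ⟨A, z1, I, z2, B, rfl, g1, g2, hI⟩ := hmid
  have m1 : M G x u1 z1 := ⟨g1, (hW z1 (by simp)).2.2⟩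
  have m2 : M G x u2 z2 := ⟨g2, (hW z2 (by simp)).2.2⟩
  have k1 : ¬ G.Adj u2 z1 := C.nadj h1 h2 h12 m1
  have k2 : ¬ G.Adj u1 z2 := C.nadj h2 h1 h12.symm m2
  have zu1 : z1 ≠ u2 := (hW z1 (by simp)).2.1
  have zu2 : z2 ≠ u1 := (hW z2 (by simp)).1
  have hIW : ∀ i ∈ I, i ≠ u1 ∧ i ≠ u2 ∧ i ≠ x ∧ ¬ G.Adj x i := fun i hi => hW i (by simp [hi])
  have hseg : Seg G (z1 :: (I ++ [z2])) z1 z2 := by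
    refine ⟨?_, by simp, by rw [List.getLast?_cons]; simp⟩
    have := hQ1.1
    rw [show A ++ z1 :: (I ++ z2 :: B) = (A ++ z1 :: (I ++ [z2])) ++ B by simp] at this
    exact this.left_of_append.right_of_append
  have hzz : G.Adj z1 z2 := by
    by_cases e12 : G.Adj u1 u2
    · obtain ⟨j, hj, hw⟩ := C.hadh {v | v ∈ u1 :: z1 :: (I ++ [z2])}
        (seg_cn (hseg.cons g1) (fun _ => Iff.rfl)) u1 (by simp) z2 (by simp) 2
        ⟨u2, trivial, e12, z2, trivial, g2, rfl⟩
      have hmem : ∀ p, p ∈ {v | v ∈ u1 :: z1 :: (I ++ [z2])} → p = u1 ∨ p = z1 ∨ p ∈ I ∨ p = z2 := by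
        intro p hp
        simpa using hp
      have hp1 : ∀ p, p ∈ {v | v ∈ u1 :: z1 :: (I ++ [z2])} → G.Adj u1 p → p = z1 := by
        intro p hp e
        rcases hmem p hp with rfl | h | h | rfl
        · exact absurd rfl e.ne
        · exact h
        · exact absurd e (hI p h).1
        · exact absurd e k2
      match j, hj, hw with
      | 0, _, hw => exact absurd hw.symm zu2
      | 1, _, ⟨z', _, e, hz'⟩ =>
        have hz' : z' = z2 := hz'
        exact absurd (hz' ▸ e) k2
      | 2, _, ⟨p, hp, e, z', _, e', hz'⟩ =>
        have hz' : z' = z2 := hz'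
        subst hz'
        rw [← hp1 p hp e]; exact e'
      | 3, _, ⟨p, hp, e, q, hq, e', z', _, e'', hz'⟩ =>
        have hz' : z' = z2 := hz'
        subst hz'
        have := hp1 p hp e
        subst this
        rcases hmem q hq with rfl | rfl | h | rfl
        · exact absurd e'' k2
        · exact e''
        · exact (C.b2 h1 h2 e12 m1 m2 (hI q h).1 (hI q h).2 e'.symm e'').elim
        · exact e'
    · have hs2 : Seg G ((u1 :: z1 :: (I ++ [z2])) ++ [u2]) u1 u2 :=
        (hseg.cons g1).append (Seg.single G u2) g2.symm
      obtain ⟨j, hj, hw⟩ := C.hadh {v | v ∈ (u1 :: z1 :: (I ++ [z2])) ++ [u2]}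
        (seg_cn hs2 (fun _ => Iff.rfl)) u1 (by simp) u2 (by simp) 2
        ⟨x, trivial, h1.symm, u2, trivial, h2, rfl⟩
      have hmem : ∀ p, p ∈ {v | v ∈ (u1 :: z1 :: (I ++ [z2])) ++ [u2]} →
          p = u1 ∨ p = z1 ∨ p ∈ I ∨ p = z2 ∨ p = u2 := by
        intro p hp
        simpa using hp
      have hp1 : ∀ p, p ∈ {v | v ∈ (u1 :: z1 :: (I ++ [z2])) ++ [u2]} → G.Adj u1 p → p = z1 := by
        intro p hp e
        rcases hmem p hp with rfl | h | h | rfl | rfl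
        · exact absurd rfl e.ne
        · exact h
        · exact absurd e (hI p h).1
        · exact absurd e k2
        · exact absurd e e12
      have hp2 : ∀ p, p ∈ {v | v ∈ (u1 :: z1 :: (I ++ [z2])) ++ [u2]} → G.Adj u2 p → p = z2 := by
        intro p hp e
        rcases hmem p hp with rfl | rfl | h | h | rfl
        · exact absurd e.symm e12
        · exact absurd e k1
        · exact absurd e (hI p h).2
        · exact h
        · exact absurd rfl e.ne
      match j, hj, hw with
      | 0, _, hw => exact absurd hw h12
      | 1, _, ⟨z', _, e, hz'⟩ =>
        have hz' : z' = u2 := hz'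
        exact absurd (hz' ▸ e) e12
      | 2, _, ⟨p, hp, e, z', _, e', hz'⟩ =>
        have hz' : z' = u2 := hz'
        subst hz'
        have := hp1 p hp e
        subst this
        exact absurd e'.symm k1
      | 3, _, ⟨p, hp, e, q, hq, e', z', _, e'', hz'⟩ =>
        have hz' : z' = u2 := hz'
        subst hz'
        rw [← hp1 p hp e, ← hp2 q hq e''.symm]
        exact e'
  match I, hI, hIW, hseg, nd, HN, hQ1 with
  | [], _, _, _, _, HN, hQ1 =>
    rw [show A ++ z1 :: ([] ++ z2 :: B) = (A ++ [z1]) ++ (z2 :: B) by simp] at hQ1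
    obtain ⟨b, c, s1, s2, -⟩ := hQ1.split (by simp) (by simp)
    have hb : z1 = b := by have := s1.2.2; simpa using this
    have hc : z2 = c := by have := s2.2.1; simpa using this
    subst hb; subst hc
    refine HN ([x] ++ ([u1] ++ ((A ++ [z1]).reverse ++ (Q2.reverse ++ ((z2 :: B).reverse ++ [u2])))))
      ⟨x, u2, (Seg.single G x).append ((Seg.single G u1).append (s1.reverse.append
        (hQ2.reverse.append (s2.reverse.append (Seg.single G u2) g2.symm) A2) A1) g1) h1,
        h2.symm⟩ ?_
    classical
    rw [List.perm_iff_count]; intro v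
    simp [List.count_append, List.count_cons]; omega
  | c :: I', hI, hIW, hseg, _, _, _ =>
    obtain ⟨-, d, hs, ec⟩ := hseg.split_cons (by simp)
    have hd : c = d := by have := hs.2.1; simpa using this
    subst hd
    have hc := hI c (by simp)
    have hcz : c ≠ z2 := by rintro rfl; exact hc.2 g2
    have := C.second m1 ec.symm hzz.symm hc.1 k2 (hIW c (by simp)).1 zu2 hcz
    exact C.tri h1 h2 h12 m1 m2 hzz ec.symm this

theorem main_aux : ∀ (n : ℕ) (V : Type u) [Finite V] (G : SimpleGraph V), Nat.card V = n →
    ClawFree G → ADH G → TC G Set.univ → HamL G := by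
  intro n
  induction n using Nat.strong_induction_on with
  | _ n ih =>
    intro V _ G hn hcf hadh htc
    by_contra nh
    have hmin : ∀ S : Set V, S ≠ Set.univ → TC G S → CycOn G S := by
      intro S hS ht
      refine cycOn_of_induce (ih (Nat.card S) ?_ S (G.induce S) rfl (ClawFree_induce hcf S)
        (hadh.induce S) ht.induce)
      rw [← hn, Nat.card_coe_set_eq, ← Set.ncard_univ]
      exact Set.ncard_lt_ncard (Set.ssubset_univ_iff.2 hS) (Set.toFinite _)
    obtain ⟨x, hx⟩ := exists_typeI hcf hadh htc nh hmin
    exact Ctx.final ⟨hcf, hadh, htc, nh, hx, diamond_free hcf htc nh hmin⟩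

end Adh

/-- Every 2-connected, claw-free, almost distance-hereditary graph on at least
three vertices is Hamiltonian. -/
theorem hamiltonian_of_clawFree_adh {V : Type*} [Fintype V] [DecidableEq V] (G : SimpleGraph V)
    (h3 : 3 ≤ Fintype.card V)
    (h2conn : ∀ v : V, (G.induce {v}ᶜ).Connected)
    (hcf : ClawFree G) (hadh : AlmostDH G) :
    G.IsHamiltonian := by
  exact Adh.isHamiltonian_of_hamL h3 (Adh.main_aux _ V G rfl hcf (Adh.adh_of hadh)
    (Adh.tc_of h3 h2conn))
end

section
/- Let G be a non-Hamiltonian graph on n vertices, C a longest cycle with a fixed orientation, R a component of G − V(C), and v_i, v_j distinct vertices of C joined by a path with internal vertices in R, with v_i⁻v_i⁺ ∈ Ẽ(G). If l is a common neighbor of v_i and v_j⁻ lying on the segment C[v_i, v_j⁻] (traversed in the orientation of C), then l⁻l⁺ ∉ Ẽ(G) and v_i l⁺ ∉ Ẽ(G). -/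
open SimpleGraph

/-- The list `L` is a path of `G` from `x` to `y`. -/
def PL {V : Type*} (G : SimpleGraph V) (L : List V) (x y : V) : Prop :=
  L.head? = some x ∧ L.getLast? = some y ∧ L.IsChain G.Adj ∧ L.Nodup

theorem PL.append {V : Type*} {G : SimpleGraph V} {L M : List V} {x y z w : V}
    (h1 : PL G L x y) (h2 : PL G M z w) (h : G.Adj y z) (hd : ∀ t ∈ L, t ∉ M) :
    PL G (L ++ M) x w := by
  obtain ⟨a1, a2, a3, a4⟩ := h1
  obtain ⟨b1, b2, b3, b4⟩ := h2
  refine ⟨by simp [a1], by simp [b2], ?_, ?_⟩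
  · rw [List.isChain_append]
    refine ⟨a3, b3, ?_⟩
    intro s hs t ht
    rw [a2] at hs; rw [b1] at ht
    simp at hs ht
    subst hs; subst ht; exact h
  · rw [List.nodup_append']
    exact ⟨a4, b4, fun t h1 h2 => hd t h1 h2⟩

theorem PL.reverse {V : Type*} {G : SimpleGraph V} {L : List V} {x y : V}
    (h1 : PL G L x y) : PL G L.reverse y x := by
  obtain ⟨a1, a2, a3, a4⟩ := h1
  refine ⟨by simp [a2], by simp [a1], ?_, by simpa using a4⟩
  rw [List.isChain_reverse]
  exact a3.imp fun _ _ h => h.symm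

theorem PL.single {V : Type*} (G : SimpleGraph V) (x : V) : PL G [x] x x := by
  simp [PL]

theorem PL.cycle {V : Type*} {G : SimpleGraph V} {L : List V} {x y : V}
    (h1 : PL G L x y) (h : G.Adj y x) (h3 : 3 ≤ L.length) :
    ∃ g : ZMod L.length → V, IsCycleMap G L.length g := by
  obtain ⟨a1, a2, a3, a4⟩ := h1
  haveI : NeZero L.length := ⟨by omega⟩
  haveI : Fact (1 < L.length) := ⟨by omega⟩
  refine ⟨fun i => L[i.val]'(ZMod.val_lt i), h3, ?_, ?_⟩
  · intro i j hij
    have := (List.Nodup.getElem_inj_iff a4).1 hij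
    exact ZMod.val_injective _ this
  · intro i
    have hi := ZMod.val_lt i
    by_cases hlt : i.val + 1 < L.length
    · have e : (i + 1).val = i.val + 1 := by
        rw [ZMod.val_add_of_lt] <;> simp [ZMod.val_one]; exact hlt
      simp only [e]
      exact List.isChain_iff_getElem.1 a3 _ hlt
    · have e0 : i.val = L.length - 1 := by omega
      have e : (i + 1).val = 0 := by
        rw [ZMod.val_add, ZMod.val_one, e0, Nat.sub_add_cancel (by omega), Nat.mod_self]
      simp only [e, e0]
      rw [List.head?_eq_getElem?] at a1
      rw [List.getLast?_eq_getElem?] at a2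
      rw [List.getElem?_eq_some_iff] at a1 a2
      obtain ⟨_, a1⟩ := a1
      obtain ⟨_, a2⟩ := a2
      rw [a1, a2]; exact h

/-- segment of a sequence -/
def sg {V : Type*} (F : ℕ → V) (i j : ℕ) : List V := (List.range' i (j - i)).map F

theorem mem_sg {V : Type*} {F : ℕ → V} {i j : ℕ} {x : V} :
    x ∈ sg F i j ↔ ∃ t, i ≤ t ∧ t < j ∧ F t = x := by
  simp only [sg, List.mem_map, List.mem_range'_1]
  constructor
  · rintro ⟨t, h, rfl⟩; exact ⟨t, by omega, by omega, rfl⟩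
  · rintro ⟨t, h, h', rfl⟩; exact ⟨t, by omega, rfl⟩

theorem length_sg {V : Type*} {F : ℕ → V} {i j : ℕ} : (sg F i j).length = j - i := by
  simp [sg]

theorem PL.sg {V : Type*} {G : SimpleGraph V} {F : ℕ → V} {k : ℕ}
    (hF : ∀ t, t + 1 < k → G.Adj (F t) (F (t + 1)))
    (hinj : ∀ s t, s < k → t < k → F s = F t → s = t)
    {i j : ℕ} (hij : i < j) (hj : j ≤ k) : PL G (sg F i j) (F i) (F (j - 1)) := by
  refine ⟨?_, ?_, ?_, ?_⟩
  · rw [_root_.sg, List.head?_map, List.head?_range', if_neg (by omega)]; rfl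
  · rw [_root_.sg, List.getLast?_map, List.getLast?_range', if_neg (by omega)]
    simp; congr 1; omega
  · rw [List.isChain_iff_getElem]
    intro t ht
    rw [length_sg] at ht
    simp only [_root_.sg, List.getElem_map, List.getElem_range']
    have := hF (i + t) (by omega)
    simpa [add_assoc] using this
  · rw [_root_.sg]
    refine List.Nodup.map_on ?_ List.nodup_range'
    intro s hs t ht e
    rw [List.mem_range'_1] at hs ht
    exact hinj s t (by omega) (by omega) e

/-- shifting a cycle map to a sequence -/
theorem shift_facts {V : Type*} {k : ℕ} (hk : 3 ≤ k) {g : ZMod k → V}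
    (hg : Function.Injective g) (i : ZMod k) :
    ∀ s t, s < k → t < k → g (i + (s : ℕ)) = g (i + (t : ℕ)) → s = t := by
  intro s t hs ht e
  have := add_left_cancel (hg e)
  rw [ZMod.natCast_eq_natCast_iff'] at this
  rwa [Nat.mod_eq_of_lt hs, Nat.mod_eq_of_lt ht] at this

theorem core {V : Type*} [Fintype V] (G : SimpleGraph V) (k : ℕ) (hk : 3 ≤ k)
    (g : ZMod k → V) (hg : Function.Injective g) (i₀ : ZMod k)
    (hadj : ∀ i, i ≠ i₀ → G.Adj (g i) (g (i + 1)))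
    (hdeg : Fintype.card V ≤ (G.neighborSet (g (i₀ + 1))).ncard + (G.neighborSet (g i₀)).ncard) :
    ∃ (k' : ℕ) (g' : ZMod k' → V), k ≤ k' ∧ IsCycleMap G k' g' := by
  haveI : NeZero k := ⟨by omega⟩
  set F : ℕ → V := fun t => g (i₀ + 1 + (t : ℕ)) with hFdef
  have hinj : ∀ s t, s < k → t < k → F s = F t → s = t := shift_facts hk hg _
  have hlast : F (k - 1) = g i₀ := by
    simp only [hFdef]
    congr 1
    rw [Nat.cast_sub (by omega)]; simp
  have h0 : F 0 = g (i₀ + 1) := by simp [hFdef]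
  have hF : ∀ t, t + 1 < k → G.Adj (F t) (F (t + 1)) := by
    intro t ht
    have := hadj (i₀ + 1 + (t : ℕ)) (by
      intro e
      have e2 : F t = F (k - 1) := by rw [hlast]; simp only [hFdef]; rw [e]
      have := hinj _ _ (by omega) (by omega) e2
      omega)
    simpa [hFdef, add_assoc] using this
  by_cases hw : ∃ w, w ∉ Set.range g ∧ G.Adj (g (i₀ + 1)) w ∧ G.Adj (g i₀) w
  · obtain ⟨w, hw, hu, hv⟩ := hw
    have P := (PL.sg hF hinj (i := 0) (j := k) (by omega) le_rfl).append (PL.single G w)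
      (by rw [hlast]; exact hv) (by
        intro t ht ht'
        rw [mem_sg] at ht
        obtain ⟨s, -, -, rfl⟩ := ht
        simp at ht'
        exact hw ⟨_, ht'⟩)
    have hl : (sg F 0 k ++ [w]).length = k + 1 := by simp [length_sg]
    obtain ⟨g', hg'⟩ := P.cycle (by rw [h0]; exact hu.symm) (by omega)
    exact ⟨_, g', by omega, hg'⟩
  by_cases hi : ∃ i, G.Adj (g (i₀ + 1)) (g (i + 1)) ∧ G.Adj (g i₀) (g i)
  · obtain ⟨i, hu, hv⟩ := hi
    obtain ⟨t, ht, rfl⟩ : ∃ t : ℕ, t < k ∧ i = i₀ + 1 + (t : ℕ) :=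
      ⟨(i - (i₀ + 1)).val, ZMod.val_lt _, by simp⟩
    have ht2 : t ≠ k - 1 := by
      rintro rfl
      have : F (k - 1) = g i₀ := hlast
      simp only [hFdef] at this
      rw [this] at hv
      exact hv.ne rfl
    have P := (PL.sg hF hinj (i := 0) (j := t + 1) (by omega) (by omega)).append
      (PL.sg hF hinj (i := t + 1) (j := k) (by omega) le_rfl).reverse
      (by rw [hlast]; exact hv.symm) (by
        intro x hx hx'
        rw [List.mem_reverse] at hx'
        rw [mem_sg] at hx hx'
        obtain ⟨s, _, _, rfl⟩ := hx
        obtain ⟨s', _, _, e⟩ := hx'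
        have := hinj _ _ (by omega) (by omega) e
        omega)
    have hl : (sg F 0 (t + 1) ++ (sg F (t + 1) k).reverse).length = k := by
      simp [length_sg]; omega
    obtain ⟨g', hg'⟩ := P.cycle (by
      rw [h0]; simpa [hFdef, add_assoc] using hu.symm) (by omega)
    exact ⟨_, g', by omega, hg'⟩
  exfalso
  push Not at hw hi
  have hψ : ∀ x : V, ∃ y, (∃ i, g (i + 1) = x ∧ y = g i) ∨ (x ∉ Set.range g ∧ y = x) := by
    intro x
    by_cases hx : x ∈ Set.range g
    · obtain ⟨i, rfl⟩ := hx
      exact ⟨g (i - 1), Or.inl ⟨i - 1, by simp, rfl⟩⟩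
    · exact ⟨x, Or.inr ⟨hx, rfl⟩⟩
  choose ψ hψ using hψ
  have ψinj : Function.Injective ψ := by
    intro x y e
    rcases hψ x with ⟨i, rfl, hx⟩ | ⟨hx, hx'⟩ <;> rcases hψ y with ⟨j, rfl, hy⟩ | ⟨hy, hy'⟩
    · rw [hx, hy] at e; rw [hg e]
    · exact absurd ⟨i, by rw [← hx, e, hy']⟩ hy
    · exact absurd ⟨j, by rw [← hy, ← e, hx']⟩ hx
    · rw [← hx', e, hy']
  have hdis : Disjoint (ψ '' G.neighborSet (g (i₀ + 1))) (insert (g i₀) (G.neighborSet (g i₀))) := by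
    rw [Set.disjoint_left]
    rintro _ ⟨x, hx, rfl⟩ h
    rw [mem_neighborSet] at hx
    rcases hψ x with ⟨i, rfl, h'⟩ | ⟨h1, h'⟩
    · rw [h'] at h
      rcases h with h | h
      · rw [hg h] at hx; exact hx.ne rfl
      · exact hi i hx h
    · rw [h'] at h
      rcases h with h | h
      · exact h1 ⟨_, h.symm⟩
      · exact hw x h1 hx h
  have c1 := Set.ncard_union_eq hdis (Set.toFinite _) (Set.toFinite _)
  rw [Set.ncard_image_of_injective _ ψinj, Set.ncard_insert_of_notMem (by simp) (Set.toFinite _)] at c1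
  have c2 := Set.ncard_le_card (ψ '' G.neighborSet (g (i₀ + 1)) ∪ insert (g i₀) (G.neighborSet (g i₀)))
  rw [Nat.card_eq_fintype_card] at c2
  omega

theorem addEdge {V : Type*} [Fintype V] (G : SimpleGraph V) (u v : V) (h : TEdge G u v)
    (k : ℕ) (g : ZMod k → V) (hg : IsCycleMap (G ⊔ edge u v) k g) :
    ∃ (k' : ℕ) (g' : ZMod k' → V), k ≤ k' ∧ IsCycleMap G k' g' := by
  obtain ⟨hk, hinj, hadj⟩ := hg
  by_cases hall : ∀ i, G.Adj (g i) (g (i + 1))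
  · exact ⟨k, g, le_rfl, hk, hinj, hall⟩
  push Not at hall
  obtain ⟨i₀, h₀⟩ := hall
  have key : ∀ i, ¬ G.Adj (g i) (g (i + 1)) →
      (g i = u ∧ g (i + 1) = v) ∨ (g i = v ∧ g (i + 1) = u) := by
    intro i hi
    have := hadj i
    rw [sup_adj, edge_adj] at this
    rcases this with h | h
    · exact absurd h hi
    · tauto
  have h2 : (2 : ZMod k) ≠ 0 := by
    intro e
    have : ((2 : ℕ) : ZMod k) = 0 := by exact_mod_cast e
    rw [ZMod.natCast_eq_zero_iff] at this
    have := Nat.le_of_dvd (by norm_num) this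
    omega
  refine core G k hk g hinj i₀ ?_ ?_
  · intro i hne
    by_contra hi
    have A := key i hi
    have B := key i₀ h₀
    have C : g i = g i₀ ∨ (g i = g (i₀ + 1) ∧ g (i + 1) = g i₀) := by
      rcases A with ⟨a1, a2⟩ | ⟨a1, a2⟩ <;> rcases B with ⟨b1, b2⟩ | ⟨b1, b2⟩ <;>
        simp [a1, a2, b1, b2]
    rcases C with C | ⟨C, D⟩
    · exact hne (hinj C)
    · have C := hinj C
      have D := hinj D
      rw [C] at D
      apply h2
      linear_combination D
  · rcases h.2 with h | h
    · exfalso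
      rcases key i₀ h₀ with ⟨b1, b2⟩ | ⟨b1, b2⟩ <;> rw [b1, b2] at h₀
      · exact h₀ h
      · exact h₀ h.symm
    · rcases key i₀ h₀ with ⟨b1, b2⟩ | ⟨b1, b2⟩ <;> rw [b1, b2] <;> omega

theorem TEdge.mono {V : Type*} [Fintype V] {G H : SimpleGraph V} (hGH : G ≤ H) {u v : V}
    (h : TEdge G u v) : TEdge H u v := by
  refine ⟨h.1, h.2.imp (fun h => hGH h) fun h' => h'.trans ?_⟩
  exact Nat.add_le_add
    (Set.ncard_le_ncard (fun x (hx : G.Adj u x) => (hGH hx : H.Adj u x)) (Set.toFinite _))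
    (Set.ncard_le_ncard (fun x (hx : G.Adj v x) => (hGH hx : H.Adj v x)) (Set.toFinite _))

theorem noLong {V : Type*} [Fintype V] {G : SimpleGraph V} {m : ℕ} {f : ZMod m → V}
    (hC : IsLongestCycleMap G m f) {x y z w : V} (h1 : TEdge G x y) (h2 : TEdge G z w)
    {L : List V} {s t : V} (hL : PL (G ⊔ edge x y ⊔ edge z w) L s t)
    (hts : (G ⊔ edge x y ⊔ edge z w).Adj t s) (hm : m < L.length) : False := by
  have := hC.1.1
  obtain ⟨g, hg⟩ := hL.cycle hts (by omega)
  obtain ⟨k, g, hk, hg⟩ := addEdge _ _ _ (h2.mono le_sup_left) _ g hg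
  obtain ⟨k', g, hk', hg⟩ := addEdge _ _ _ h1 _ g hg
  have := hC.2 _ _ hg
  omega

theorem seqForm {V : Type*} [Fintype V] {G : SimpleGraph V} {m : ℕ} {f : ZMod m → V}
    (hC : IsLongestCycleMap G m f) (F : ℕ → V)
    (hF : ∀ t, G.Adj (F t) (F (t + 1)))
    (hinj : ∀ s t, s < m → t < m → F s = F t → s = t)
    (s k : ℕ) (hk : 1 ≤ k) (hks : k + 2 ≤ s) (hs : s < m)
    (Q : List V) (q : V) (hQ : PL G Q (F 0) q) (hQs : G.Adj q (F s)) (hQl : 2 ≤ Q.length)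
    (hQd : ∀ x ∈ Q, ∀ t, 1 ≤ t → t < m → F t ≠ x)
    (hvi : TEdge G (F (m - 1)) (F 1))
    (hl1 : G.Adj (F k) (F 0)) (hl2 : G.Adj (F k) (F (s - 1))) :
    ¬ TEdge G (F (k - 1)) (F (k + 1)) ∧ ¬ TEdge G (F 0) (F (k + 1)) := by
  have second : ¬ TEdge G (F 0) (F (k + 1)) := by
    intro hT
    set H := G ⊔ edge (F (m - 1)) (F 1) ⊔ edge (F 0) (F (k + 1)) with hH
    have hGH : G ≤ H := le_sup_left.trans le_sup_left
    have hF' : ∀ t, t + 1 < m → H.Adj (F t) (F (t + 1)) := fun t _ => hGH (hF t)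
    have hQ' : PL H Q (F 0) q := ⟨hQ.1, hQ.2.1, hQ.2.2.1.imp fun _ _ h => hGH h, hQ.2.2.2⟩
    have e1 : H.Adj (F (m - 1)) (F 1) := by
      simp [hH, edge_adj, hvi.1]
    have e2 : H.Adj (F (k + 1)) (F 0) := by
      simp [hH, edge_adj, hT.1.symm]
    have P := ((hQ'.append (PL.sg hF' hinj (i := s) (j := m) (by omega) (by omega)) (hGH hQs) (by
        intro x hx hx'
        obtain ⟨t, _, _, e⟩ := mem_sg.1 hx'
        exact hQd x hx t (by omega) (by omega) e)).append
      (PL.sg hF' hinj (i := 1) (j := k + 1) (by omega) (by omega)) e1 (by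
        intro x hx hx'
        obtain ⟨t, _, _, e⟩ := mem_sg.1 hx'
        rcases List.mem_append.1 hx with hx | hx
        · exact hQd x hx t (by omega) (by omega) e
        · obtain ⟨t', _, _, e'⟩ := mem_sg.1 hx
          have := hinj t t' (by omega) (by omega) (e.trans e'.symm)
          omega)).append
      (PL.sg hF' hinj (i := k + 1) (j := s) (by omega) (by omega)).reverse (hGH hl2) (by
        intro x hx hx'
        obtain ⟨t, _, _, e⟩ := mem_sg.1 (List.mem_reverse.1 hx')
        rcases List.mem_append.1 hx with hx | hx
        · rcases List.mem_append.1 hx with hx | hx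
          · exact hQd x hx t (by omega) (by omega) e
          · obtain ⟨t', _, _, e'⟩ := mem_sg.1 hx
            have := hinj t t' (by omega) (by omega) (e.trans e'.symm)
            omega
        · obtain ⟨t', _, _, e'⟩ := mem_sg.1 hx
          have := hinj t t' (by omega) (by omega) (e.trans e'.symm)
          omega)
    exact noLong hC hvi hT P e2 (by simp [length_sg]; omega)
  refine ⟨?_, second⟩
  intro hT
  rcases Nat.lt_or_ge k 2 with hk2 | hk2
  · obtain rfl : k = 1 := by omega
    exact second hT
  set H := G ⊔ edge (F (m - 1)) (F 1) ⊔ edge (F (k - 1)) (F (k + 1)) with hH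
  have hGH : G ≤ H := le_sup_left.trans le_sup_left
  have hF' : ∀ t, t + 1 < m → H.Adj (F t) (F (t + 1)) := fun t _ => hGH (hF t)
  have hQ' : PL H Q (F 0) q := ⟨hQ.1, hQ.2.1, hQ.2.2.1.imp fun _ _ h => hGH h, hQ.2.2.2⟩
  have e1 : H.Adj (F (m - 1)) (F 1) := by
    simp [hH, edge_adj, hvi.1]
  have e2 : H.Adj (F (k - 1)) (F (k + 1)) := by
    simp [hH, edge_adj, hT.1]
  have P := (((hQ'.append (PL.sg hF' hinj (i := s) (j := m) (by omega) (by omega)) (hGH hQs) (by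
        intro x hx hx'
        obtain ⟨t, _, _, e⟩ := mem_sg.1 hx'
        exact hQd x hx t (by omega) (by omega) e)).append
      (PL.sg hF' hinj (i := 1) (j := k) (by omega) (by omega)) e1 (by
        intro x hx hx'
        obtain ⟨t, _, _, e⟩ := mem_sg.1 hx'
        rcases List.mem_append.1 hx with hx | hx
        · exact hQd x hx t (by omega) (by omega) e
        · obtain ⟨t', _, _, e'⟩ := mem_sg.1 hx
          have := hinj t t' (by omega) (by omega) (e.trans e'.symm)
          omega)).append
      (PL.sg hF' hinj (i := k + 1) (j := s) (by omega) (by omega)) e2 (by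
        intro x hx hx'
        obtain ⟨t, _, _, e⟩ := mem_sg.1 hx'
        rcases List.mem_append.1 hx with hx | hx
        · rcases List.mem_append.1 hx with hx | hx
          · exact hQd x hx t (by omega) (by omega) e
          · obtain ⟨t', _, _, e'⟩ := mem_sg.1 hx
            have := hinj t t' (by omega) (by omega) (e.trans e'.symm)
            omega
        · obtain ⟨t', _, _, e'⟩ := mem_sg.1 hx
          have := hinj t t' (by omega) (by omega) (e.trans e'.symm)
          omega)).append (PL.single H (F k)) (hGH hl2.symm) (by
        intro x hx hx'
        have e : F k = x := (List.mem_singleton.1 hx').symm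
        rcases List.mem_append.1 hx with hx | hx
        · rcases List.mem_append.1 hx with hx | hx
          · rcases List.mem_append.1 hx with hx | hx
            · exact hQd x hx k (by omega) (by omega) e
            · obtain ⟨t', _, _, e'⟩ := mem_sg.1 hx
              have := hinj k t' (by omega) (by omega) (e.trans e'.symm)
              omega
          · obtain ⟨t', _, _, e'⟩ := mem_sg.1 hx
            have := hinj k t' (by omega) (by omega) (e.trans e'.symm)
            omega
        · obtain ⟨t', _, _, e'⟩ := mem_sg.1 hx
          have := hinj k t' (by omega) (by omega) (e.trans e'.symm)
          omega)
  exact noLong hC hvi hT P (hGH hl1) (by simp [length_sg]; omega)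

theorem pathList {V : Type*} {G : SimpleGraph V} {x y : V} (p : G.Walk x y) (hp : p.IsPath) :
    PL G p.support x y := by
  refine ⟨?_, ?_, p.isChain_adj_support, hp.support_nodup⟩
  · rw [List.head?_eq_some_head p.support_ne_nil]; simp
  · rw [List.getLast?_eq_some_getLast p.support_ne_nil]; simp

theorem pathInit {V : Type*} {G : SimpleGraph V} {x y : V} (p : G.Walk x y) (hp : p.IsPath)
    (hlen : 2 ≤ p.length) : ∃ (Q : List V) (q : V), PL G Q x q ∧ G.Adj q y ∧ 2 ≤ Q.length ∧
      (∀ t ∈ Q, t ∈ p.support ∧ t ≠ y) := by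
  obtain ⟨r, hr⟩ : ∃ r, r = p.reverse := ⟨_, rfl⟩
  have hrp : r.IsPath := by rw [hr]; exact hp.reverse
  have hrl : r.length = p.length := by rw [hr]; simp
  have hrs : ∀ t, t ∈ r.support → t ∈ p.support := by intro t; rw [hr]; simp
  clear hr
  cases r with
  | nil => simp at hrl; omega
  | cons h r' =>
    rw [Walk.cons_isPath_iff] at hrp
    refine ⟨_, _, (pathList r' hrp.1).reverse, h.symm, ?_, ?_⟩
    · simp at hrl ⊢; omega
    · intro t ht
      rw [List.mem_reverse] at ht
      refine ⟨hrs t (by simp [ht]), ?_⟩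
      rintro rfl
      exact hrp.2 ht

/-- Lemma 3(d): assume `v_i⁻v_i⁺ ∈ Ẽ(G)` and let `l = f c` lie on the oriented
segment `C[v_i, v_j⁻]` and be a common neighbor of `v_i` and `v_j⁻`. Then
`l⁻l⁺ ∉ Ẽ(G)` and `v_i l⁺ ∉ Ẽ(G)`. -/
theorem lemma3d {V : Type*} [Fintype V] [DecidableEq V] (G : SimpleGraph V)
    (hnh : ¬ G.IsHamiltonian)
    (m : ℕ) (f : ZMod m → V) (hC : IsLongestCycleMap G m f)
    (R : Set V) (hR : IsCompOf G (Set.range f)ᶜ R)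
    (a b : ZMod m) (hab : a ≠ b)
    (p : G.Walk (f a) (f b)) (hp : p.IsPath) (hlen : 2 ≤ p.length)
    (hint : ∀ x ∈ p.support, x ≠ f a → x ≠ f b → x ∈ R)
    (hvi : TEdge G (f (a - 1)) (f (a + 1)))
    (c : ZMod m) (hseg : (c - a).val ≤ ((b - 1) - a).val)
    (hl1 : G.Adj (f c) (f a)) (hl2 : G.Adj (f c) (f (b - 1))) :
    ¬ TEdge G (f (c - 1)) (f (c + 1)) ∧ ¬ TEdge G (f a) (f (c + 1)) := by
  have hm := hC.1.1
  haveI : NeZero m := ⟨by omega⟩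
  haveI : Fact (1 < m) := ⟨by omega⟩
  obtain ⟨Q, q, hQ, hQs, hQl, hQm⟩ := pathInit p hp hlen
  set F : ℕ → V := fun t => f (a + (t : ℕ)) with hFdef
  have hinj : ∀ s t, s < m → t < m → F s = F t → s = t := shift_facts hm hC.1.2.1 _
  have hF : ∀ t, G.Adj (F t) (F (t + 1)) := by
    intro t
    simpa [hFdef, add_assoc] using hC.1.2.2 (a + (t : ℕ))
  obtain ⟨k, hk⟩ : ∃ k, k = (c - a).val := ⟨_, rfl⟩
  obtain ⟨s', hs'⟩ : ∃ s', s' = ((b - 1) - a).val := ⟨_, rfl⟩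
  have hkc : c = a + (k : ℕ) := by rw [hk]; simp
  have hsb : b - 1 = a + (s' : ℕ) := by rw [hs']; simp
  have hs'm : s' < m := by rw [hs']; exact ZMod.val_lt _
  have hsb' : b = a + ((s' + 1 : ℕ) : ZMod m) := by
    push_cast; linear_combination hsb
  have hs1 : s' + 1 < m := by
    by_contra hcon
    have : s' + 1 = m := by omega
    rw [this] at hsb'
    simp at hsb'
    exact hab hsb'.symm
  have hk0 : k ≠ 0 := by
    rintro rfl
    simp at hkc
    rw [hkc] at hl1
    exact hl1.ne rfl
  have hks : k ≠ s' := by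
    intro e
    rw [hkc, hsb, e] at hl2
    exact hl2.ne rfl
  have hle : k ≤ s' := by rw [hk, hs']; exact hseg
  have h0 : F 0 = f a := by simp [hFdef]
  have hFb : F (s' + 1) = f b := by rw [hsb']
  have hFk : F k = f c := by rw [hkc]
  have hFs : F (s' + 1 - 1) = f (b - 1) := by rw [hsb]; rfl
  have hFm : F (m - 1) = f (a - 1) := by
    simp only [hFdef]
    congr 1
    rw [Nat.cast_sub (by omega)]; simp [sub_eq_add_neg]
  have hF1 : F 1 = f (a + 1) := by simp [hFdef]
  have hFk1 : F (k + 1) = f (c + 1) := by rw [hkc]; simp [hFdef, add_assoc]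
  have hFk2 : F (k - 1) = f (c - 1) := by
    rw [hkc]; simp only [hFdef]
    rw [Nat.cast_sub (by omega)]; congr 1; push_cast; ring
  have := seqForm hC F hF hinj (s' + 1) k (by omega) (by omega) hs1 Q q (by rw [h0]; exact hQ)
    (by rw [hFb]; exact hQs) hQl (by
      rintro x hx t ht1 htm rfl
      obtain ⟨h1, h2⟩ := hQm _ hx
      by_cases h3 : F t = f a
      · rw [← h0] at h3
        have := hinj _ _ htm (by omega) h3
        omega
      · exact hR.2.1 (hint _ h1 h3 h2) ⟨_, rfl⟩)
    (by rw [hFm, hF1]; exact hvi) (by rw [hFk, h0]; exact hl1) (by rw [hFk, hFs]; exact hl2)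
  rwa [hFk2, hFk1, h0] at this
end
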